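/- arXiv:math/0510456 — 4 statements merged into one kernel-verified Lean document; each statement's English description precedes it below -/
import Mathlib

section
/- Let f be a real polynomial in n variables of degree r_f, and let r be a natural number with 2r ≥ r_f. Consider the set F of linear functionals L : A_{2r} → ℝ satisfying L(Θ_r) ≤ 1 and L(h²) ≥ 0 for every polynomial h ∈ A_r. Then F is nonempty, and the infimum ε_r* of L(f) over L ∈ F is finite and attained: there exists L* ∈ F with L*(f) = ε_r* and L*(f) ≤ L(f) for all L ∈ F. -/
open MvPolynomial

/-- `Θ_r = 1 + ∑_{j=1}^n X_j^{2r}`. -/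
noncomputable def Theta (n r : ℕ) : MvPolynomial (Fin n) ℝ :=
  1 + ∑ j : Fin n, X j ^ (2 * r)

/-- The feasible set `F` of the semidefinite program: linear functionals `L` on the
polynomials (their values on `A_{2r}` are what matters) with `L(Θ_r) ≤ 1` and
`L(h²) ≥ 0` for all `h ∈ A_r`. -/
def Feasible (n r : ℕ) (L : MvPolynomial (Fin n) ℝ →ₗ[ℝ] ℝ) : Prop :=
  L (Theta n r) ≤ 1 ∧ ∀ h : MvPolynomial (Fin n) ℝ, h.totalDegree ≤ r → 0 ≤ L (h ^ 2)

theorem le_of_midpoint_convex {n r : ℕ} {y : (Fin n →₀ ℕ) → ℝ}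
    (hy : ∀ a b c : Fin n →₀ ℕ, a.degree ≤ r → b.degree ≤ r → a + b = c + c →
      2 * y c ≤ y a + y b)
    (h0 : y 0 ≤ 1) (hr : ∀ j, y (Finsupp.single j r) ≤ 1)
    (c : Fin n →₀ ℕ) (hc : c.degree ≤ r) : y c ≤ 1 + (r : ℝ) ^ 2 := by
  have hfin : {d : Fin n →₀ ℕ | d.degree ≤ r}.Finite := Finsupp.finite_of_degree_le r
  obtain ⟨m, hm, hmax⟩ := hfin.exists_maximalFor
    (fun d => y d + ∑ i, (d i : ℝ) ^ 2) _ ⟨c, hc⟩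
  have hle : ∀ d : Fin n →₀ ℕ, d.degree ≤ r →
      y d + ∑ i, (d i : ℝ) ^ 2 ≤ y m + ∑ i, (m i : ℝ) ^ 2 := fun d hd => by
    rcases le_total (y d + ∑ i, (d i : ℝ) ^ 2) (y m + ∑ i, (m i : ℝ) ^ 2) with h | h
    · exact h
    · exact hmax hd h
  have hext : ∀ a b : Fin n →₀ ℕ, a.degree ≤ r → b.degree ≤ r → a + b = m + m → a = b := by
    intro a b ha hb hab
    have hsum : ∑ i, ((a i : ℝ) - b i) ^ 2 =
        2 * ∑ i, (a i : ℝ) ^ 2 + 2 * ∑ i, (b i : ℝ) ^ 2 - 4 * ∑ i, (m i : ℝ) ^ 2 := by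
      simp only [Finset.mul_sum, ← Finset.sum_add_distrib, ← Finset.sum_sub_distrib]
      refine Finset.sum_congr rfl fun i _ => ?_
      have h : (a i : ℝ) + b i = m i + m i := by exact_mod_cast DFunLike.congr_fun hab i
      linear_combination (-(a i : ℝ) - b i - 2 * m i) * h
    have hzero : ∑ i, ((a i : ℝ) - b i) ^ 2 = 0 :=
      le_antisymm (by linarith [hle a ha, hle b hb, hy a b m ha hb hab])
        (Finset.sum_nonneg fun i _ => sq_nonneg _)
    rw [Finset.sum_eq_zero_iff_of_nonneg fun i _ => sq_nonneg _] at hzero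
    ext i
    have := pow_eq_zero_iff two_ne_zero |>.1 (hzero i (Finset.mem_univ i))
    exact_mod_cast sub_eq_zero.1 this
  have hcm : y c ≤ y m + ∑ i, (m i : ℝ) ^ 2 :=
    le_trans (le_add_of_nonneg_right (Finset.sum_nonneg fun i _ => sq_nonneg _)) (hle c hc)
  refine hcm.trans ?_
  by_cases hm0 : m = 0
  · subst hm0
    simpa using h0.trans (le_add_of_nonneg_right (sq_nonneg (r : ℝ)))
  obtain ⟨i, hi⟩ := Finsupp.ne_iff.1 hm0
  obtain ⟨d, rfl⟩ : ∃ d, m = d + Finsupp.single i 1 :=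
    ⟨m - Finsupp.single i 1, (tsub_add_cancel_of_le (by
      rw [Finsupp.single_le_iff]; exact Nat.one_le_iff_ne_zero.2 hi)).symm⟩
  have hm' : d.degree + 1 ≤ r := by simpa using hm
  have hdeg : d.degree + 1 = r := by
    by_contra hne
    have := hext (d + Finsupp.single i 2) d (by simp; omega) (by omega) (by
      ext k; simp [Finsupp.single_apply]; split_ifs <;> omega)
    simpa using DFunLike.congr_fun this i
  have hoff : ∀ j, j ≠ i → d j = 0 := by
    intro j hji
    by_contra hj
    obtain ⟨e, rfl⟩ : ∃ e, d = e + Finsupp.single j 1 :=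
      ⟨d - Finsupp.single j 1, (tsub_add_cancel_of_le (by
        rw [Finsupp.single_le_iff]; exact Nat.one_le_iff_ne_zero.2 hj)).symm⟩
    have he : e.degree + 1 + 1 = r := by simpa using hdeg
    have := hext (e + Finsupp.single i 2) (e + Finsupp.single j 2) (by simp; omega)
      (by simp; omega) (by
        ext k; simp [Finsupp.single_apply]; split_ifs <;> omega)
    simpa [hji] using DFunLike.congr_fun this i
  have hd : d = Finsupp.single i (d i) := by
    ext k
    by_cases hk : k = i
    · simp [hk]
    · simp [hoff k hk, Ne.symm hk]
  have hdi : d i + 1 = r := by rw [hd] at hdeg; simpa using hdeg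
  have hs : d + Finsupp.single i 1 = Finsupp.single i r := by
    rw [hd, ← Finsupp.single_add, hdi]
  rw [hs, Finset.sum_eq_single i (fun k _ hk => by simp [Ne.symm hk])
    (by simp)]
  simpa using hr i

theorem Finsupp.exists_add_degree_le {σ : Type*} {r : ℕ} (c : σ →₀ ℕ) (hc : c.degree ≤ 2 * r) :
    ∃ a b : σ →₀ ℕ, a + b = c ∧ a.degree ≤ r ∧ b.degree ≤ r := by
  obtain ⟨a, hac, ha⟩ := c.exists_le_degree_eq (min r c.degree) (min_le_right _ _)
  obtain ⟨b, rfl⟩ := exists_add_of_le hac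
  refine ⟨a, b, rfl, by omega, ?_⟩
  simp only [map_add] at hc ha
  omega

theorem Feasible.abs_monomial_le {n r : ℕ} {L : MvPolynomial (Fin n) ℝ →ₗ[ℝ] ℝ}
    (hL : Feasible n r L) (c : Fin n →₀ ℕ) (hc : c.degree ≤ 2 * r) :
    |L (monomial c 1)| ≤ 1 + (r : ℝ) ^ 2 := by
  have htd : ∀ a : Fin n →₀ ℕ, a.degree ≤ r →
      (monomial a (1 : ℝ)).totalDegree ≤ r := fun a ha => by
    rw [totalDegree_monomial _ one_ne_zero]
    exact ha
  have hsub : ∀ a b : Fin n →₀ ℕ, a.degree ≤ r → b.degree ≤ r →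
      2 * L (monomial (a + b) 1) ≤ L (monomial (a + a) 1) + L (monomial (b + b) 1) := by
    intro a b ha hb
    have h := hL.2 (monomial a 1 - monomial b 1)
      ((totalDegree_sub _ _).trans (max_le (htd a ha) (htd b hb)))
    have e : (monomial a (1 : ℝ) - monomial b 1) ^ 2 =
        monomial (a + a) 1 - (2 : ℝ) • monomial (a + b) 1 + monomial (b + b) 1 := by
      have h1 : ∀ p q : Fin n →₀ ℕ, monomial (p + q) (1 : ℝ) = monomial p 1 * monomial q 1 :=
        fun p q => by simp [monomial_mul]
      rw [h1, h1, h1, two_smul]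
      ring
    rw [e] at h
    simp only [map_add, map_sub, map_smul, smul_eq_mul] at h
    linarith
  have hadd : ∀ a b : Fin n →₀ ℕ, a.degree ≤ r → b.degree ≤ r →
      -(2 * L (monomial (a + b) 1)) ≤ L (monomial (a + a) 1) + L (monomial (b + b) 1) := by
    intro a b ha hb
    have h := hL.2 (monomial a 1 + monomial b 1)
      ((totalDegree_add _ _).trans (max_le (htd a ha) (htd b hb)))
    have e : (monomial a (1 : ℝ) + monomial b 1) ^ 2 =
        monomial (a + a) 1 + (2 : ℝ) • monomial (a + b) 1 + monomial (b + b) 1 := by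
      have h1 : ∀ p q : Fin n →₀ ℕ, monomial (p + q) (1 : ℝ) = monomial p 1 * monomial q 1 :=
        fun p q => by simp [monomial_mul]
      rw [h1, h1, h1, two_smul]
      ring
    rw [e] at h
    simp only [map_add, map_smul, smul_eq_mul] at h
    linarith
  have hone : 0 ≤ L 1 := by simpa using hL.2 1 (by simp)
  have hX : ∀ j, 0 ≤ L (X j ^ (2 * r)) := fun j => by
    have := hL.2 (X j ^ r) (by simp)
    rwa [← pow_mul, mul_comm] at this
  have hT : L 1 + ∑ j, L (X j ^ (2 * r)) ≤ 1 := by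
    simpa [Theta, map_add, map_sum] using hL.1
  have hdiag : ∀ a : Fin n →₀ ℕ, a.degree ≤ r → L (monomial (a + a) 1) ≤ 1 + (r : ℝ) ^ 2 := by
    refine le_of_midpoint_convex (y := fun a => L (monomial (a + a) 1)) ?_ ?_ ?_
    · intro a b c ha hb habc
      have := hsub a b ha hb
      rwa [habc] at this
    · have : L (monomial (0 + 0) 1) = L 1 := by simp
      simp only [this]
      linarith [Finset.sum_nonneg fun j (_ : j ∈ Finset.univ) => hX j]
    · intro j
      have : L (monomial (Finsupp.single j r + Finsupp.single j r) 1) = L (X j ^ (2 * r)) := by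
        rw [← Finsupp.single_add, X_pow_eq_monomial, two_mul]
      simp only [this]
      linarith [Finset.single_le_sum (fun j _ => hX j) (Finset.mem_univ j)]
  obtain ⟨a, b, rfl, ha, hb⟩ := Finsupp.exists_add_degree_le c hc
  rw [abs_le]
  constructor <;> linarith [hsub a b ha hb, hadd a b ha hb, hdiag a ha, hdiag b hb]

/-- The linear functional on polynomials with prescribed moments. -/
noncomputable def momentFunctional {n : ℕ} (y : (Fin n →₀ ℕ) → ℝ) :
    MvPolynomial (Fin n) ℝ →ₗ[ℝ] ℝ :=
  (basisMonomials (Fin n) ℝ).constr ℝ y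

theorem momentFunctional_monomial {n : ℕ} (y : (Fin n →₀ ℕ) → ℝ) (c : Fin n →₀ ℕ) :
    momentFunctional y (monomial c 1) = y c := by
  simpa [momentFunctional] using (basisMonomials (Fin n) ℝ).constr_basis ℝ y c

theorem map_eq_sum_coeff_mul {n : ℕ} (L : MvPolynomial (Fin n) ℝ →ₗ[ℝ] ℝ)
    (p : MvPolynomial (Fin n) ℝ) :
    L p = ∑ c ∈ p.support, p.coeff c * L (monomial c 1) := by
  conv_lhs => rw [p.as_sum]
  rw [map_sum]
  refine Finset.sum_congr rfl fun c _ => ?_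
  rw [← smul_eq_mul, ← map_smul, smul_monomial, smul_eq_mul, mul_one]

theorem continuous_momentFunctional {n : ℕ} (p : MvPolynomial (Fin n) ℝ) :
    Continuous fun y : (Fin n →₀ ℕ) → ℝ => momentFunctional y p := by
  simp only [map_eq_sum_coeff_mul (momentFunctional _) p, momentFunctional_monomial]
  fun_prop

theorem map_eq_of_totalDegree_le {n d : ℕ} {L M : MvPolynomial (Fin n) ℝ →ₗ[ℝ] ℝ}
    (h : ∀ c : Fin n →₀ ℕ, c.degree ≤ d → L (monomial c 1) = M (monomial c 1))
    {p : MvPolynomial (Fin n) ℝ} (hp : p.totalDegree ≤ d) : L p = M p := by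
  rw [map_eq_sum_coeff_mul L, map_eq_sum_coeff_mul M]
  refine Finset.sum_congr rfl fun c hc => ?_
  rw [h c ((le_totalDegree hc).trans hp)]

theorem totalDegree_Theta_le (n r : ℕ) : (Theta n r).totalDegree ≤ 2 * r := by
  refine (totalDegree_add _ _).trans (max_le (by simp) ?_)
  exact totalDegree_finsetSum_le fun j _ => by simp

theorem Feasible.congr {n r : ℕ} {L M : MvPolynomial (Fin n) ℝ →ₗ[ℝ] ℝ} (hL : Feasible n r L)
    (h : ∀ c : Fin n →₀ ℕ, c.degree ≤ 2 * r → L (monomial c 1) = M (monomial c 1)) :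
    Feasible n r M := by
  refine ⟨map_eq_of_totalDegree_le h (totalDegree_Theta_le n r) ▸ hL.1, fun p hp => ?_⟩
  rw [← map_eq_of_totalDegree_le h
    ((totalDegree_pow p 2).trans (Nat.mul_le_mul_left 2 hp))]
  exact hL.2 p hp

theorem isClosed_feasible_momentFunctional (n r : ℕ) :
    IsClosed {y : (Fin n →₀ ℕ) → ℝ | Feasible n r (momentFunctional y)} := by
  simp only [Feasible, Set.ofPred_and, Set.ofPred_forall]
  exact (isClosed_le (continuous_momentFunctional _) continuous_const).inter
    (isClosed_iInter fun h => isClosed_iInter fun _ =>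
      isClosed_le continuous_const (continuous_momentFunctional _))

/-- The feasible set is nonempty and the infimum `ε_r^*` of `L(f)` over it is
finite and attained by some `L^*`. -/
theorem stmt_0 (n : ℕ) (f : MvPolynomial (Fin n) ℝ) (r : ℕ)
    (hdeg : f.totalDegree ≤ 2 * r) :
    ∃ Lstar : MvPolynomial (Fin n) ℝ →ₗ[ℝ] ℝ,
      Feasible n r Lstar ∧
      ∀ L : MvPolynomial (Fin n) ℝ →ₗ[ℝ] ℝ, Feasible n r L → Lstar f ≤ L f := by
  classical
  let B : (Fin n →₀ ℕ) → ℝ := fun c => if c.degree ≤ 2 * r then 1 + (r : ℝ) ^ 2 else 0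
  let K : Set ((Fin n →₀ ℕ) → ℝ) := Set.univ.pi fun c => Set.Icc (-B c) (B c)
  have hK : IsCompact (K ∩ {y | Feasible n r (momentFunctional y)}) :=
    (isCompact_univ_pi fun _ => isCompact_Icc).inter_right
      (isClosed_feasible_momentFunctional n r)
  have key : ∀ L, Feasible n r L →
      ∃ y ∈ K ∩ {y | Feasible n r (momentFunctional y)}, momentFunctional y f = L f := by
    intro L hL
    let y : (Fin n →₀ ℕ) → ℝ := fun c => if c.degree ≤ 2 * r then L (monomial c 1) else 0
    have hy : ∀ c : Fin n →₀ ℕ, c.degree ≤ 2 * r →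
        L (monomial c 1) = momentFunctional y (monomial c 1) := fun c hc => by
      rw [momentFunctional_monomial]
      exact (if_pos hc).symm
    refine ⟨y, ⟨fun c _ => ?_, hL.congr hy⟩, (map_eq_of_totalDegree_le hy hdeg).symm⟩
    by_cases hc : c.degree ≤ 2 * r
    · simpa only [y, B, if_pos hc, Set.mem_Icc, abs_le] using hL.abs_monomial_le c hc
    · simp [y, B, hc]
  have hzero : Feasible n r 0 := ⟨by simp, fun _ _ => by simp⟩
  obtain ⟨y₀, hy₀, -⟩ := key 0 hzero
  obtain ⟨y, hy, hmin⟩ := hK.exists_isMinOn ⟨y₀, hy₀⟩ (continuous_momentFunctional f).continuousOn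
  refine ⟨momentFunctional y, hy.2, fun L hL => ?_⟩
  obtain ⟨z, hz, hzf⟩ := key L hL
  exact hzf ▸ hmin hz
end

section
/- Let f be a real polynomial in n variables of degree r_f that is nonnegative on the cube [−1,1]^n, and for each r with 2r ≥ r_f let ε_r* be the minimum of L(f) over all linear functionals L : A_{2r} → ℝ satisfying L(Θ_r) ≤ 1 and L(h²) ≥ 0 for every h ∈ A_r. Then ε_r* → 0 as r → ∞. -/
open MvPolynomial

open Filter Topology

section Sequences

theorem convex_seq_le_of_bounded {a : ℕ → ℝ} (h : ∀ k, 2 * a (k + 1) ≤ a k + a (k + 2))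
    {B : ℝ} (hB : ∀ k, a k ≤ B) : a 1 ≤ a 0 := by
  by_contra! hlt
  have hstep : ∀ k, a 1 - a 0 ≤ a (k + 1) - a k := by
    intro k
    induction k with
    | zero => simp
    | succ k ih => linarith [h k]
  have hlin : ∀ k : ℕ, a 0 + k * (a 1 - a 0) ≤ a k := by
    intro k
    induction k with
    | zero => simp
    | succ k ih => push_cast; linarith [hstep k]
  obtain ⟨k, hk⟩ := exists_nat_gt ((B - a 0) / (a 1 - a 0))
  rw [div_lt_iff₀ (by linarith)] at hk
  linarith [hlin k, hB k]

theorem convex_seq_le_one {a : ℕ → ℝ} {r : ℕ}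
    (h : ∀ k, k + 2 ≤ r → 2 * a (k + 1) ≤ a k + a (k + 2)) (h0 : a 0 ≤ 1) (hr : a r ≤ 1)
    {k : ℕ} (hk : k ≤ r) : a k ≤ 1 := by
  have hslope : ∀ k : ℕ, k + 1 ≤ r → (k + 1) * (a k - 1) ≤ k * (a (k + 1) - 1) := by
    intro k
    induction k with
    | zero => intro _; simpa using h0
    | succ k ih =>
      intro hk
      have h1 := ih (by omega)
      have h2 := h k (by omega)
      have h3 : (0 : ℝ) ≤ k + 1 := by positivity
      have h4 := mul_le_mul_of_nonneg_left h2 h3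
      push_cast
      rw [show k + 1 + 1 = k + 2 from rfl]
      linarith
  by_contra! hlt
  have hpos : ∀ m, k ≤ m → m ≤ r → 1 < a m := by
    intro m hm
    induction m, hm using Nat.le_induction with
    | base => intro _; exact hlt
    | succ m hm ih =>
      intro hmr
      have h1 := ih (by omega)
      have h2 := hslope m hmr
      have h3 : 0 < (m : ℝ) * (a (m + 1) - 1) :=
        lt_of_lt_of_le (mul_pos (by positivity) (by linarith)) h2
      have := pos_of_mul_pos_right h3 (Nat.cast_nonneg m)
      linarith
  linarith [hpos r hk le_rfl]

end Sequences

section PositiveFunctionals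

variable {σ : Type*}

/-- A linear functional on polynomials, nonnegative on squares and with bounded moments. -/
structure IsBoundedPositive (L : MvPolynomial σ ℝ →ₗ[ℝ] ℝ) : Prop where
  nonneg : ∀ p, 0 ≤ L (p ^ 2)
  bounded : ∃ B, ∀ α, |L (monomial α 1)| ≤ B

theorem map_mul_le_half {L : MvPolynomial σ ℝ →ₗ[ℝ] ℝ} {p q : MvPolynomial σ ℝ}
    (h₁ : 0 ≤ L ((p + q) ^ 2)) (h₂ : 0 ≤ L ((p - q) ^ 2)) :
    |L (p * q)| ≤ (L (p ^ 2) + L (q ^ 2)) / 2 := by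
  have e₁ : (p + q) ^ 2 = p ^ 2 + q ^ 2 + (2 : ℝ) • (p * q) := by
    rw [two_smul]; ring
  have e₂ : (p - q) ^ 2 = p ^ 2 + q ^ 2 - (2 : ℝ) • (p * q) := by
    rw [two_smul]; ring
  rw [e₁] at h₁
  rw [e₂] at h₂
  simp only [map_add, map_sub, map_smul, smul_eq_mul] at h₁ h₂
  rw [abs_le]
  constructor <;> linarith

theorem linearMap_ext_monomial {L L' : MvPolynomial σ ℝ →ₗ[ℝ] ℝ}
    (h : ∀ α, L (monomial α 1) = L' (monomial α 1)) : L = L' :=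
  (basisMonomials σ ℝ).ext fun α => by simpa only [coe_basisMonomials] using h α

namespace IsBoundedPositive

variable {L : MvPolynomial σ ℝ →ₗ[ℝ] ℝ}

theorem bounded_mul (hL : IsBoundedPositive L) (q : MvPolynomial σ ℝ) :
    ∃ B, ∀ α, |L (q * monomial α 1)| ≤ B := by
  induction q using MvPolynomial.induction_on' with
  | monomial β c =>
    obtain ⟨B, hB⟩ := hL.bounded
    refine ⟨|c| * B, fun α => ?_⟩
    have : monomial β c * monomial α 1 = c • monomial (β + α) (1 : ℝ) := by
      rw [monomial_mul, smul_monomial, smul_eq_mul]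
    rw [this, map_smul, smul_eq_mul, abs_mul]
    exact mul_le_mul_of_nonneg_left (hB _) (abs_nonneg c)
  | add p q hp hq =>
    obtain ⟨B₁, h₁⟩ := hp
    obtain ⟨B₂, h₂⟩ := hq
    refine ⟨B₁ + B₂, fun α => ?_⟩
    rw [add_mul, map_add]
    exact (abs_add_le _ _).trans (add_le_add (h₁ α) (h₂ α))

theorem map_X_sq_mul_le (hL : IsBoundedPositive L) (j : σ) (p : MvPolynomial σ ℝ) :
    L (X j ^ 2 * p ^ 2) ≤ L (p ^ 2) := by
  obtain ⟨B, hB⟩ := hL.bounded_mul (p ^ 2)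
  have := convex_seq_le_of_bounded (a := fun k => L (X j ^ (2 * k) * p ^ 2)) (B := B) ?_ ?_
  · simpa using this
  · intro k
    have h := hL.nonneg (X j ^ k * (1 - X j ^ 2) * p)
    have e : (X j ^ k * (1 - X j ^ 2) * p) ^ 2 = X j ^ (2 * k) * p ^ 2
        + X j ^ (2 * (k + 2)) * p ^ 2 - (2 : ℝ) • (X j ^ (2 * (k + 1)) * p ^ 2) := by
      rw [two_smul]; ring
    rw [e, map_sub, map_add, map_smul, smul_eq_mul] at h
    linarith
  · intro k
    have h := hB (Finsupp.single j (2 * k))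
    rw [← X_pow_eq_monomial, mul_comm] at h
    exact (le_abs_self _).trans h

theorem mul_one_add (hL : IsBoundedPositive L) (j : σ) {s : ℝ} (hs : s ^ 2 = 1) :
    IsBoundedPositive (L ∘ₗ LinearMap.mulLeft ℝ (1 + C s * X j)) where
  nonneg p := by
    have h₁ := hL.nonneg ((1 + C s * X j) * p)
    have h₂ := hL.map_X_sq_mul_le j p
    have hC : (C s : MvPolynomial σ ℝ) ^ 2 = 1 := by rw [← C_pow, hs, C_1]
    have e : ((1 + C s * X j) * p) ^ 2
        = (2 : ℝ) • ((1 + C s * X j) * p ^ 2) + (X j ^ 2 * p ^ 2 - p ^ 2) := by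
      rw [two_smul]
      linear_combination X j ^ 2 * p ^ 2 * hC
    rw [e, map_add, map_sub, map_smul, smul_eq_mul] at h₁
    simp only [LinearMap.comp_apply, LinearMap.mulLeft_apply]
    linarith
  bounded := hL.bounded_mul _

theorem smul (hL : IsBoundedPositive L) {c : ℝ} (hc : 0 ≤ c) : IsBoundedPositive (c • L) where
  nonneg p := mul_nonneg hc (hL.nonneg p)
  bounded := by
    obtain ⟨B, hB⟩ := hL.bounded
    refine ⟨c * B, fun α => ?_⟩
    rw [LinearMap.smul_apply, smul_eq_mul, abs_mul, abs_of_nonneg hc]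
    exact mul_le_mul_of_nonneg_left (hB α) hc

theorem abs_moment_le (hL : IsBoundedPositive L) (α : σ →₀ ℕ) :
    |L (monomial α 1)| ≤ L 1 := by
  have hsq : ∀ α : σ →₀ ℕ, L (monomial α 1 ^ 2) ≤ L 1 := by
    intro α
    suffices h : ∀ p, L (monomial α 1 ^ 2 * p ^ 2) ≤ L (p ^ 2) by simpa using h 1
    induction α using Finsupp.induction_linear with
    | zero => simp
    | add α β hα hβ =>
      intro p
      rw [show (monomial (α + β) (1 : ℝ)) = monomial α 1 * monomial β 1 by
        rw [monomial_mul, one_mul], mul_pow, mul_assoc, ← mul_pow]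
      refine (hα _).trans ?_
      rw [mul_pow]
      exact hβ p
    | single j a =>
      rw [← X_pow_eq_monomial]
      induction a with
      | zero => simp
      | succ a ih =>
        intro p
        rw [pow_succ (X j) a, mul_pow, mul_assoc, ← mul_pow (X j) p]
        refine (ih _).trans ?_
        rw [mul_pow]
        exact hL.map_X_sq_mul_le j p
  have h := map_mul_le_half (hL.nonneg (1 + monomial α 1)) (hL.nonneg (1 - monomial α 1))
  rw [one_mul, one_pow] at h
  linarith [hsq α]

theorem eq_zero (hL : IsBoundedPositive L) (h1 : L 1 = 0) : L = 0 := by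
  refine linearMap_ext_monomial fun α => ?_
  have := hL.abs_moment_le α
  rw [h1] at this
  simpa using this

end IsBoundedPositive

end PositiveFunctionals

section Moments

variable {σ : Type*}

/-- The linear functional with prescribed moments. -/
noncomputable def rieszFunctional (m : (σ →₀ ℕ) → ℝ) : MvPolynomial σ ℝ →ₗ[ℝ] ℝ :=
  (basisMonomials σ ℝ).constr ℝ m

theorem rieszFunctional_monomial (m : (σ →₀ ℕ) → ℝ) (α : σ →₀ ℕ) :
    rieszFunctional m (monomial α 1) = m α := by
  simpa only [rieszFunctional, coe_basisMonomials] using (basisMonomials σ ℝ).constr_basis ℝ m α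

theorem rieszFunctional_moments (L : MvPolynomial σ ℝ →ₗ[ℝ] ℝ) :
    rieszFunctional (fun α => L (monomial α 1)) = L :=
  linearMap_ext_monomial fun α => rieszFunctional_monomial _ α

theorem rieszFunctional_combo (a b : ℝ) (m m' : (σ →₀ ℕ) → ℝ) :
    rieszFunctional (a • m + b • m') = a • rieszFunctional m + b • rieszFunctional m' := by
  simp [rieszFunctional]

theorem map_eq_sum_moments (L : MvPolynomial σ ℝ →ₗ[ℝ] ℝ) (q : MvPolynomial σ ℝ) :
    L q = ∑ α ∈ q.support, q.coeff α * L (monomial α 1) := by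
  conv_lhs => rw [q.as_sum]
  rw [map_sum]
  refine Finset.sum_congr rfl fun α _ => ?_
  rw [← smul_eq_mul, ← map_smul, smul_monomial, smul_eq_mul, mul_one]

theorem continuous_rieszFunctional_apply (q : MvPolynomial σ ℝ) :
    Continuous fun m : (σ →₀ ℕ) → ℝ => rieszFunctional m q := by
  simp_rw [map_eq_sum_moments _ q, rieszFunctional_monomial]
  fun_prop

/-- Normalized moment sequences of positive functionals, with entries in `[-1, 1]`. -/
def momentSet (σ : Type*) : Set ((σ →₀ ℕ) → ℝ) :=
  {m | (∀ α, m α ∈ Set.Icc (-1 : ℝ) 1) ∧ rieszFunctional m 1 = 1 ∧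
    ∀ p, 0 ≤ rieszFunctional m (p ^ 2)}

theorem isCompact_momentSet : IsCompact (momentSet σ) := by
  have h : IsCompact (Set.univ.pi fun _ : σ →₀ ℕ => Set.Icc (-1 : ℝ) 1) :=
    isCompact_univ_pi fun _ => isCompact_Icc
  have hc : IsClosed {m : (σ →₀ ℕ) → ℝ | rieszFunctional m 1 = 1 ∧
      ∀ p, 0 ≤ rieszFunctional m (p ^ 2)} := by
    refine (isClosed_eq (continuous_rieszFunctional_apply 1) continuous_const).inter ?_
    change IsClosed {m : (σ →₀ ℕ) → ℝ | ∀ p, 0 ≤ rieszFunctional m (p ^ 2)}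
    rw [show {m : (σ →₀ ℕ) → ℝ | ∀ p, 0 ≤ rieszFunctional m (p ^ 2)} =
        ⋂ p : MvPolynomial σ ℝ, {m | 0 ≤ rieszFunctional m (p ^ 2)} by
      ext m
      simp]
    exact isClosed_iInter fun p =>
      isClosed_le continuous_const (continuous_rieszFunctional_apply (p ^ 2))
  convert h.inter_right hc using 1
  ext m
  simp only [momentSet, Set.mem_inter_iff, Set.mem_univ_pi]
  rfl

theorem isBoundedPositive_of_mem_momentSet {m : (σ →₀ ℕ) → ℝ} (hm : m ∈ momentSet σ) :
    IsBoundedPositive (rieszFunctional m) :=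
  ⟨hm.2.2, 1, fun α => by rw [rieszFunctional_monomial, abs_le]; exact hm.1 α⟩

theorem moments_mem_momentSet {L : MvPolynomial σ ℝ →ₗ[ℝ] ℝ} (hL : IsBoundedPositive L)
    (h1 : L 1 = 1) : (fun α => L (monomial α 1)) ∈ momentSet σ := by
  refine ⟨fun α => abs_le.1 ((hL.abs_moment_le α).trans h1.le), ?_⟩
  rw [rieszFunctional_moments]
  exact ⟨h1, hL.nonneg⟩

theorem rieszFunctional_X_mul_of_extreme {K : Set ((σ →₀ ℕ) → ℝ)} (hK : IsExtreme ℝ (momentSet σ) K)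
    {m : (σ →₀ ℕ) → ℝ} (hm : m ∈ K.extremePoints ℝ) (j : σ) (q : MvPolynomial σ ℝ) :
    rieszFunctional m (X j * q) = rieszFunctional m (X j) * rieszFunctional m q := by
  replace hm := hK.extremePoints_subset_extremePoints hm
  set L := rieszFunctional m with hLdef
  have hL : IsBoundedPositive L := isBoundedPositive_of_mem_momentSet hm.1
  have hL1 : L 1 = 1 := hm.1.2.1
  have happ : ∀ s q, (L ∘ₗ LinearMap.mulLeft ℝ (1 + C s * X j)) q = L q + s * L (X j * q) := by
    intro s q
    rw [LinearMap.comp_apply, LinearMap.mulLeft_apply, add_mul, one_mul, map_add, mul_assoc,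
      ← smul_eq_C_mul, map_smul, smul_eq_mul]
  have hpos : ∀ s : ℝ, s ^ 2 = 1 → 0 ≤ 1 + s * L (X j) := by
    intro s hs
    have := (hL.mul_one_add j hs).nonneg 1
    rwa [one_pow, happ, hL1, mul_one] at this
  have hdeg : ∀ s : ℝ, s ^ 2 = 1 → 1 + s * L (X j) = 0 →
      L (X j * q) = L (X j) * L q := by
    intro s hs h0
    have hz := (hL.mul_one_add j hs).eq_zero (by rw [happ, hL1, mul_one, h0])
    have := congrArg (fun T => T q) hz
    rw [happ, LinearMap.zero_apply] at this
    linear_combination s * this - s * h0 * L q + (L (X j) * L q - L (X j * q)) * hs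
  have hmem : ∀ s : ℝ, s ^ 2 = 1 → 0 < 1 + s * L (X j) →
      (fun α => ((1 + s * L (X j))⁻¹ • (L ∘ₗ LinearMap.mulLeft ℝ (1 + C s * X j)))
        (monomial α 1)) ∈ momentSet σ := by
    intro s hs h0
    refine moments_mem_momentSet ((hL.mul_one_add j hs).smul (inv_nonneg.2 h0.le)) ?_
    rw [LinearMap.smul_apply, happ, hL1, mul_one, smul_eq_mul, inv_mul_cancel₀ h0.ne']
  rcases (hpos 1 (by norm_num)).eq_or_lt' with hp | hp
  · exact hdeg 1 (by norm_num) hp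
  rcases (hpos (-1) (by norm_num)).eq_or_lt' with hn | hn
  · exact hdeg (-1) (by norm_num) hn
  have heq := hm.2 (hmem 1 (by norm_num) hp) (hmem (-1) (by norm_num) hn)
    ⟨(1 + 1 * L (X j)) / 2, (1 + -1 * L (X j)) / 2, by linarith, by linarith, by ring, ?_⟩
  · have h2 := rieszFunctional_moments
      ((1 + 1 * L (X j))⁻¹ • (L ∘ₗ LinearMap.mulLeft ℝ (1 + C 1 * X j)))
    rw [heq, ← hLdef] at h2
    have h3 := congrArg (fun T => T q) h2
    simp only [LinearMap.smul_apply, happ, smul_eq_mul] at h3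
    rw [one_mul, one_mul] at h3
    rw [one_mul] at hp
    have h4 := mul_inv_cancel₀ hp.ne'
    linear_combination -(1 + L (X j)) * h3 - (L q + L (X j * q)) * h4
  · funext α
    simp only [Pi.add_apply, Pi.smul_apply, LinearMap.smul_apply, happ, smul_eq_mul]
    rw [← rieszFunctional_monomial m α, ← hLdef]
    have h₁ := mul_inv_cancel₀ hp.ne'
    have h₂ := mul_inv_cancel₀ hn.ne'
    linear_combination (L (monomial α 1) + L (X j * monomial α 1)) / 2 * h₁
      + (L (monomial α 1) - L (X j * monomial α 1)) / 2 * h₂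

theorem nonneg_of_mem_momentSet {f : MvPolynomial σ ℝ}
    (hf : ∀ x : σ → ℝ, (∀ i, |x i| ≤ 1) → 0 ≤ eval x f) {m₀ : (σ →₀ ℕ) → ℝ}
    (hm₀ : m₀ ∈ momentSet σ) : 0 ≤ rieszFunctional m₀ f := by
  have hcont := continuous_rieszFunctional_apply f
  obtain ⟨m₁, hm₁, hmin⟩ := isCompact_momentSet.exists_isMinOn ⟨m₀, hm₀⟩ hcont.continuousOn
  rw [isMinOn_iff] at hmin
  set v := rieszFunctional m₁ f
  set F : Set ((σ →₀ ℕ) → ℝ) := {m ∈ momentSet σ | rieszFunctional m f ≤ v}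
  have hF : IsCompact F :=
    isCompact_momentSet.inter_right (isClosed_le hcont continuous_const)
  have hext : IsExtreme ℝ (momentSet σ) F := by
    refine ⟨fun _ h => h.1, ?_⟩
    rintro x hx y hy z hz ⟨a, b, ha, hb, hab, rfl⟩
    refine ⟨hx, ?_⟩
    have h := hz.2
    simp only [rieszFunctional_combo, LinearMap.add_apply, LinearMap.smul_apply,
      smul_eq_mul] at h
    have h2 := mul_le_mul_of_nonneg_left (hmin y hy) hb.le
    have h3 : a * rieszFunctional x f ≤ a * v := by
      have : v = a * v + b * v := by rw [← add_mul, hab, one_mul]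
      linarith
    exact le_of_mul_le_mul_left h3 ha
  obtain ⟨m, hm⟩ := hF.extremePoints_nonempty ⟨m₁, hm₁, le_rfl⟩
  have hmF := hm.1
  have heval : ∀ q, rieszFunctional m q = eval (fun j => rieszFunctional m (X j)) q := by
    intro q
    induction q using MvPolynomial.induction_on with
    | C c =>
      rw [eval_C, show (C c : MvPolynomial σ ℝ) = c • 1 by rw [smul_eq_C_mul, mul_one],
        map_smul, hmF.1.2.1, smul_eq_mul, mul_one]
    | add p q hp hq => rw [map_add, map_add, hp, hq]
    | mul_X p j hp =>
      rw [mul_comm, rieszFunctional_X_mul_of_extreme hext hm, hp, map_mul, eval_X]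
  have hge : 0 ≤ rieszFunctional m f := by
    rw [heval]
    refine hf _ fun j => ?_
    rw [X, rieszFunctional_monomial, abs_le]
    exact hmF.1.1 _
  exact hge.trans (hmF.2.trans (hmin m₀ hm₀))

theorem IsBoundedPositive.nonneg_of_nonneg_on_cube {L : MvPolynomial σ ℝ →ₗ[ℝ] ℝ}
    (hL : IsBoundedPositive L) {f : MvPolynomial σ ℝ}
    (hf : ∀ x : σ → ℝ, (∀ i, |x i| ≤ 1) → 0 ≤ eval x f) : 0 ≤ L f := by
  have h0 : 0 ≤ L 1 := by simpa using hL.nonneg 1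
  rcases h0.eq_or_lt' with h | h
  · rw [hL.eq_zero h, LinearMap.zero_apply]
  · have h1 := nonneg_of_mem_momentSet hf (moments_mem_momentSet (hL.smul (inv_nonneg.2 h0))
      (by rw [LinearMap.smul_apply, smul_eq_mul, inv_mul_cancel₀ h.ne']))
    rw [rieszFunctional_moments, LinearMap.smul_apply, smul_eq_mul] at h1
    exact (mul_nonneg_iff_of_pos_left (inv_pos.2 h)).1 h1

end Moments

section Feasible

variable {n : ℕ}

theorem Feasible.map_one_le_and_X_pow_le {r : ℕ} {L : MvPolynomial (Fin n) ℝ →ₗ[ℝ] ℝ}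
    (hL : Feasible n r L) : L 1 ≤ 1 ∧ ∀ j, L (X j ^ (2 * r)) ≤ 1 := by
  have h1 : 0 ≤ L 1 := by simpa using hL.2 1 (by simp)
  have hX : ∀ j ∈ Finset.univ, 0 ≤ L (X j ^ (2 * r)) := by
    intro j _
    have := hL.2 (X j ^ r) (by simp)
    rwa [← pow_mul, mul_comm r 2] at this
  have h := hL.1
  rw [Theta, map_add, map_sum] at h
  refine ⟨by linarith [Finset.sum_nonneg hX], fun j => ?_⟩
  linarith [Finset.single_le_sum hX (Finset.mem_univ j)]

theorem Feasible.map_X_pow_le {r : ℕ} {L : MvPolynomial (Fin n) ℝ →ₗ[ℝ] ℝ}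
    (hL : Feasible n r L) (j : Fin n) {k : ℕ} (hk : k ≤ r) : L (X j ^ (2 * k)) ≤ 1 := by
  obtain ⟨h1, hX⟩ := hL.map_one_le_and_X_pow_le
  refine convex_seq_le_one (a := fun k => L (X j ^ (2 * k))) ?_ (by simpa using h1) (hX j) hk
  intro k hk
  have hdeg : (X j ^ k - X j ^ (k + 2) : MvPolynomial (Fin n) ℝ).totalDegree ≤ r := by
    refine (totalDegree_sub _ _).trans ?_
    rw [totalDegree_X_pow, totalDegree_X_pow]
    omega
  have h := hL.2 _ hdeg
  have e : (X j ^ k - X j ^ (k + 2) : MvPolynomial (Fin n) ℝ) ^ 2 = X j ^ (2 * k)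
      + X j ^ (2 * (k + 2)) - (2 : ℝ) • X j ^ (2 * (k + 1)) := by
    rw [two_smul]; ring
  rw [e, map_sub, map_add, map_smul, smul_eq_mul] at h
  linarith

theorem Feasible.abs_map_mul_le {r : ℕ} {L : MvPolynomial (Fin n) ℝ →ₗ[ℝ] ℝ}
    (hL : Feasible n r L) {p q : MvPolynomial (Fin n) ℝ} (hp : p.totalDegree ≤ r)
    (hq : q.totalDegree ≤ r) (hp1 : L (p ^ 2) ≤ 1) (hq1 : L (q ^ 2) ≤ 1) :
    |L (p * q)| ≤ 1 := by
  have := map_mul_le_half (hL.2 (p + q) ((totalDegree_add _ _).trans (max_le hp hq)))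
    (hL.2 (p - q) ((totalDegree_sub _ _).trans (max_le hp hq)))
  linarith

theorem eventually_abs_moment_le_one (α : Fin n →₀ ℕ) :
    ∀ᶠ r in atTop, ∀ L, Feasible n r L → |L (monomial α 1)| ≤ 1 := by
  suffices h : ∀ k : ℕ, ∀ᶠ r in atTop, ∀ L, Feasible n r L →
      |L (monomial α 1 ^ k)| ≤ 1 by simpa using h 1
  induction α using Finsupp.induction_linear with
  | zero =>
    refine fun k => Eventually.of_forall fun r L hL => ?_
    have h1 : 0 ≤ L 1 := by simpa using hL.2 1 (by simp)
    rw [monomial_zero', C_1, one_pow, abs_of_nonneg h1]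
    exact hL.map_one_le_and_X_pow_le.1
  | add α β hα hβ =>
    intro k
    filter_upwards [hα (2 * k), hβ (2 * k),
      eventually_ge_atTop ((monomial α (1 : ℝ)) ^ k).totalDegree,
      eventually_ge_atTop ((monomial β (1 : ℝ)) ^ k).totalDegree] with r h₁ h₂ h₃ h₄ L hL
    rw [show (monomial (α + β) (1 : ℝ)) = monomial α 1 * monomial β 1 by
      rw [monomial_mul, one_mul], mul_pow]
    refine hL.abs_map_mul_le h₃ h₄ ?_ ?_
    · rw [← pow_mul, mul_comm]; exact (le_abs_self _).trans (h₁ L hL)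
    · rw [← pow_mul, mul_comm]; exact (le_abs_self _).trans (h₂ L hL)
  | single j a =>
    intro k
    filter_upwards [eventually_ge_atTop (a * k)] with r hr L hL
    rw [← X_pow_eq_monomial, ← pow_mul, ← one_mul (X j ^ (a * k))]
    refine hL.abs_map_mul_le (by simp) (by rwa [totalDegree_X_pow]) ?_ ?_
    · rw [one_pow]; exact hL.map_one_le_and_X_pow_le.1
    · rw [← pow_mul, mul_comm]; exact hL.map_X_pow_le j hr

theorem exists_isBoundedPositive_tendsto (U : Ultrafilter ℕ) (hU : ↑U ≤ (atTop : Filter ℕ))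
    {L : ℕ → MvPolynomial (Fin n) ℝ →ₗ[ℝ] ℝ} (hL : ∀ᶠ r in U, Feasible n r (L r)) :
    ∃ T : MvPolynomial (Fin n) ℝ →ₗ[ℝ] ℝ, IsBoundedPositive T ∧
      ∀ q, Tendsto (fun r => L r q) U (𝓝 (T q)) := by
  have hlim : ∀ α : Fin n →₀ ℕ, ∃ y ∈ Set.Icc (-1 : ℝ) 1,
      Tendsto (fun r => L r (monomial α 1)) U (𝓝 y) := by
    intro α
    have hmem : ∀ᶠ r in U, L r (monomial α 1) ∈ Set.Icc (-1 : ℝ) 1 := by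
      filter_upwards [hU (eventually_abs_moment_le_one α), hL] with r h₁ h₂
      exact abs_le.1 (h₁ _ h₂)
    exact isCompact_Icc.ultrafilter_le_nhds' (U.map fun r => L r (monomial α 1)) hmem
  choose m hm hlim using hlim
  have htend : ∀ q, Tendsto (fun r => L r q) U (𝓝 (rieszFunctional m q)) := by
    intro q
    rw [map_eq_sum_moments]
    simp_rw [map_eq_sum_moments _ q, rieszFunctional_monomial]
    exact tendsto_finsetSum _ fun α _ => (hlim α).const_mul _
  refine ⟨rieszFunctional m, ⟨fun p => ?_, 1, fun α => ?_⟩, htend⟩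
  · refine ge_of_tendsto (htend (p ^ 2)) ?_
    filter_upwards [hL, hU (eventually_ge_atTop p.totalDegree)] with r h₁ h₂
    exact h₁.2 p h₂
  · rw [rieszFunctional_monomial, abs_le]
    exact hm α

end Feasible

/-- If `f` is nonnegative on `[-1,1]^n` and `ε_r^*` denotes the minimum of `L(f)` over
the feasible set (for `2r ≥ deg f`), then `ε_r^* → 0` as `r → ∞`. -/
theorem stmt_3 (n : ℕ) (f : MvPolynomial (Fin n) ℝ)
    (hf : ∀ x : Fin n → ℝ, (∀ i, |x i| ≤ 1) → 0 ≤ eval x f)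
    (e : ℕ → ℝ)
    (he : ∀ r : ℕ, f.totalDegree ≤ 2 * r →
      IsLeast {y : ℝ | ∃ L : MvPolynomial (Fin n) ℝ →ₗ[ℝ] ℝ,
        Feasible n r L ∧ L f = y} (e r)) :
    Filter.Tendsto e Filter.atTop (nhds 0) := by
  have hdeg : ∀ᶠ r in atTop, f.totalDegree ≤ 2 * r := by
    filter_upwards [eventually_ge_atTop f.totalDegree] with r hr
    omega
  refine tendsto_order.2 ⟨fun a ha => ?_, fun a ha => ?_⟩
  · by_contra hfreq
    have hfreq : ∃ᶠ r in atTop, e r ≤ a := by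
      simpa only [Filter.Frequently, not_le] using hfreq
    have : (atTop ⊓ 𝓟 {r | e r ≤ a}).NeBot := frequently_mem_iff_neBot.1 hfreq
    set U := Ultrafilter.of (atTop ⊓ 𝓟 {r | e r ≤ a})
    have hU := Ultrafilter.of_le (atTop ⊓ 𝓟 {r | e r ≤ a})
    have hUtop : ↑U ≤ (atTop : Filter ℕ) := hU.trans inf_le_left
    have hUe : ∀ᶠ r in U, e r ≤ a := (hU.trans inf_le_right) (mem_principal_self _)
    have hex : ∀ r, ∃ L : MvPolynomial (Fin n) ℝ →ₗ[ℝ] ℝ,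
        f.totalDegree ≤ 2 * r → Feasible n r L ∧ L f = e r := by
      intro r
      by_cases h : f.totalDegree ≤ 2 * r
      · obtain ⟨L, hL⟩ := (he r h).1
        exact ⟨L, fun _ => hL⟩
      · exact ⟨0, fun h' => absurd h' h⟩
    choose L hL using hex
    obtain ⟨T, hT, htend⟩ := exists_isBoundedPositive_tendsto U hUtop
      (hUtop (hdeg.mono fun r hr => (hL r hr).1))
    have hle : T f ≤ a := by
      refine le_of_tendsto (htend f) ?_
      filter_upwards [hUtop hdeg, hUe] with r h₁ h₂
      rw [(hL r h₁).2]
      exact h₂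
    linarith [hT.nonneg_of_nonneg_on_cube hf]
  · filter_upwards [hdeg] with r hr
    refine ((he r hr).2 ⟨0, ⟨?_, fun h _ => ?_⟩, rfl⟩).trans_lt ?_ <;> simp [ha]
end

section
/- Let f be a real polynomial in n variables nonnegative on the cube [−1,1]^n, and let ε > 0 be fixed. Then there exists r(f,ε) ∈ ℕ such that for every r ≥ r(f,ε), the polynomial f + ε·Θ_r is a sum of squares of polynomials. -/
open MvPolynomial

section Bernstein

theorem abs_prod_sub_prod_le {ι : Type*} (s : Finset ι) (u v : ι → ℝ)
    (hu : ∀ i ∈ s, |u i| ≤ 1) (hv : ∀ i ∈ s, |v i| ≤ 1) :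
    |∏ i ∈ s, u i - ∏ i ∈ s, v i| ≤ ∑ i ∈ s, |u i - v i| := by
  classical
  induction s using Finset.induction_on with
  | empty => simp
  | insert j s hj ih =>
    rw [Finset.prod_insert hj, Finset.prod_insert hj, Finset.sum_insert hj]
    have ih' := ih (fun i hi => hu i (Finset.mem_insert_of_mem hi))
      (fun i hi => hv i (Finset.mem_insert_of_mem hi))
    have hv1 : |∏ i ∈ s, v i| ≤ 1 := by
      rw [Finset.abs_prod]
      exact Finset.prod_le_one (fun i _ => abs_nonneg _)
        (fun i hi => hv i (Finset.mem_insert_of_mem hi))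
    have huj := hu j (Finset.mem_insert_self j s)
    calc |u j * ∏ i ∈ s, u i - v j * ∏ i ∈ s, v i|
        = |u j * (∏ i ∈ s, u i - ∏ i ∈ s, v i) + (u j - v j) * ∏ i ∈ s, v i| := by ring_nf
      _ ≤ |u j| * |∏ i ∈ s, u i - ∏ i ∈ s, v i| + |u j - v j| * |∏ i ∈ s, v i| := by
        rw [← abs_mul, ← abs_mul]; exact abs_add_le _ _
      _ ≤ 1 * |∏ i ∈ s, u i - ∏ i ∈ s, v i| + |u j - v j| * 1 := by gcongr
      _ ≤ |u j - v j| + ∑ i ∈ s, |u i - v i| := by linarith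

theorem descFactorial_div_mem_Icc {N k : ℕ} (hk : k ≤ N) (a : ℕ) :
    (k.descFactorial a : ℝ) / N.descFactorial a ∈ Set.Icc (0 : ℝ) 1 := by
  refine ⟨by positivity, div_le_one_of_le₀ ?_ (by positivity)⟩
  exact_mod_cast Nat.descFactorial_le a hk

theorem abs_descFactorial_div_sub_pow_le {N k a : ℕ} (hk : k ≤ N) (ha : a ≤ N) :
    |(k.descFactorial a : ℝ) / N.descFactorial a - ((k : ℝ) / N) ^ a| ≤ (a : ℝ) ^ 2 / N := by
  induction a with
  | zero => simp
  | succ a ih =>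
    have hN : (0 : ℝ) < N := by exact_mod_cast (by omega : 0 < N)
    have hkN : (k : ℝ) ≤ N := by exact_mod_cast hk
    have hq0 : 0 ≤ (k : ℝ) / N := by positivity
    have hq1 : (k : ℝ) / N ≤ 1 := div_le_one_of_le₀ hkN hN.le
    rcases lt_or_ge k a with hka | hka
    · have h0 : k.descFactorial (a + 1) = 0 := Nat.descFactorial_eq_zero_iff_lt.2 (by omega)
      have hka' : (k : ℝ) ≤ a := by exact_mod_cast hka.le
      rw [h0, Nat.cast_zero, zero_div, zero_sub, abs_neg, abs_of_nonneg (by positivity)]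
      calc ((k : ℝ) / N) ^ (a + 1) ≤ (k : ℝ) / N := pow_le_of_le_one hq0 hq1 (by omega)
        _ ≤ ((a + 1 : ℕ) : ℝ) ^ 2 / N := by
          gcongr
          push_cast
          nlinarith [(Nat.cast_nonneg a : (0 : ℝ) ≤ a)]
    · have haN : (0 : ℝ) < (N : ℝ) - a := by
        have : ((a + 1 : ℕ) : ℝ) ≤ N := by exact_mod_cast ha
        push_cast at this; linarith
      have hka' : (a : ℝ) ≤ k := by exact_mod_cast hka
      obtain ⟨hw0, hw1⟩ := descFactorial_div_mem_Icc hk a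
      set w : ℝ := (k.descFactorial a : ℝ) / N.descFactorial a with hw
      have hstep : (k.descFactorial (a + 1) : ℝ) / N.descFactorial (a + 1)
          = ((k : ℝ) - a) / (N - a) * w := by
        rw [Nat.descFactorial_succ, Nat.descFactorial_succ, Nat.cast_mul, Nat.cast_mul,
          Nat.cast_sub hka, Nat.cast_sub (by omega : a ≤ N), mul_div_mul_comm, hw]
      have hratio : |((k : ℝ) - a) / (N - a) - (k : ℝ) / N| ≤ a / N := by
        have : ((k : ℝ) - a) / (N - a) - (k : ℝ) / N
            = - ((a : ℝ) / N * ((N - k) / (N - a))) := by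
          field_simp; ring
        rw [this, abs_neg, abs_of_nonneg
          (mul_nonneg (by positivity) (div_nonneg (by linarith) haN.le))]
        exact mul_le_of_le_one_right (by positivity) (div_le_one_of_le₀ (by linarith) haN.le)
      calc |(k.descFactorial (a + 1) : ℝ) / N.descFactorial (a + 1) - ((k : ℝ) / N) ^ (a + 1)|
          = |(((k : ℝ) - a) / (N - a) - (k : ℝ) / N) * w
              + (k : ℝ) / N * (w - ((k : ℝ) / N) ^ a)| := by rw [hstep]; ring_nf
        _ ≤ |((k : ℝ) - a) / (N - a) - (k : ℝ) / N| * |w|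
              + |(k : ℝ) / N| * |w - ((k : ℝ) / N) ^ a| := by
          rw [← abs_mul, ← abs_mul]; exact abs_add_le _ _
        _ ≤ a / N * 1 + 1 * ((a : ℝ) ^ 2 / N) := by
          gcongr
          · rwa [abs_of_nonneg hw0]
          · rwa [abs_of_nonneg hq0]
          · exact ih (by omega)
        _ ≤ ((a + 1 : ℕ) : ℝ) ^ 2 / N := by
          rw [mul_one, one_mul, ← add_div]
          gcongr
          push_cast
          nlinarith [(Nat.cast_nonneg a : (0 : ℝ) ≤ a)]

variable {A : Type*} [CommRing A] [Algebra ℝ A]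

theorem pow_eq_sum_bernstein {N a : ℕ} (ha : a ≤ N) (y : A) :
    y ^ a = ∑ k ∈ Finset.range (N + 1),
      algebraMap ℝ A ((k.descFactorial a : ℝ) / N.descFactorial a) *
        (y ^ k * (1 - y) ^ (N - k) * (N.choose k : A)) := by
  have hN : N + 1 = a + (N - a + 1) := by omega
  rw [hN, Finset.sum_range_add, Finset.sum_eq_zero, zero_add]
  · have h1 : y ^ a = y ^ a * (y + (1 - y)) ^ (N - a) := by simp
    rw [h1, add_pow, Finset.mul_sum]
    refine Finset.sum_congr rfl fun j hj => ?_
    have hj' : j ≤ N - a := by simpa [Nat.lt_succ_iff] using hj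
    have hnat : (a + j).descFactorial a * N.choose (a + j)
        = N.descFactorial a * (N - a).choose j := by
      have := Nat.choose_mul (n := N) (k := a + j) (s := a) (by omega)
      rw [Nat.add_sub_cancel_left] at this
      rw [Nat.descFactorial_eq_factorial_mul_choose, Nat.descFactorial_eq_factorial_mul_choose,
        mul_assoc, mul_assoc, mul_comm ((a + j).choose a), this]
    have hpos : (N.descFactorial a : ℝ) ≠ 0 := by
      exact_mod_cast (Nat.descFactorial_pos.2 ha).ne'
    have hreal : ((a + j).descFactorial a : ℝ) / N.descFactorial a * (N.choose (a + j) : ℝ)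
        = ((N - a).choose j : ℝ) := by
      rw [div_mul_eq_mul_div, div_eq_iff hpos, mul_comm ((N - a).choose j : ℝ)]
      exact_mod_cast hnat
    have hA := congrArg (algebraMap ℝ A) hreal
    rw [map_mul, map_natCast, map_natCast] at hA
    rw [← hA, pow_add, show N - (a + j) = N - a - j by omega]
    ring
  · intro k hk
    rw [Nat.descFactorial_eq_zero_iff_lt.2 (Finset.mem_range.1 hk)]
    simp

theorem aeval_eq_sum_bernstein {σ : Type*} [Fintype σ] [DecidableEq σ] (y : σ → A)
    (g : MvPolynomial σ ℝ) {N : ℕ} (hN : ∀ a ∈ g.support, ∀ i, a i ≤ N) :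
    aeval y g = ∑ κ ∈ Fintype.piFinset fun _ : σ => Finset.range (N + 1),
      algebraMap ℝ A (∑ a ∈ g.support, g.coeff a *
        ∏ i, (((κ i).descFactorial (a i) : ℝ) / N.descFactorial (a i))) *
      ∏ i, (y i ^ κ i * (1 - y i) ^ (N - κ i) * (N.choose (κ i) : A)) := by
  simp_rw [map_sum, Finset.sum_mul]
  rw [Finset.sum_comm, aeval_def, eval₂_eq']
  refine Finset.sum_congr rfl fun a ha => ?_
  rw [Finset.prod_congr rfl fun i _ => pow_eq_sum_bernstein (hN a ha i) (y i),
    Finset.prod_univ_sum, Finset.mul_sum]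
  refine Finset.sum_congr rfl fun κ _ => ?_
  rw [Finset.prod_mul_distrib, map_mul, map_prod, mul_assoc]

/-- A polynomial bounded below by a positive constant on `[0,1]^σ` takes values in any
subsemiring containing the nonnegative reals when evaluated at elements `y i` of it such that
the `1 - y i` also belong to it. -/
theorem aeval_mem_of_le_eval {σ : Type*} [Fintype σ] (S : Subsemiring A)
    (hS : ∀ c : ℝ, 0 ≤ c → algebraMap ℝ A c ∈ S) (y : σ → A) (hy : ∀ i, y i ∈ S)
    (hy' : ∀ i, 1 - y i ∈ S) (g : MvPolynomial σ ℝ) {δ : ℝ} (hδ : 0 < δ)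
    (hg : ∀ x : σ → ℝ, (∀ i, 0 ≤ x i ∧ x i ≤ 1) → δ ≤ eval x g) : aeval y g ∈ S := by
  classical
  set c : ℝ := ∑ a ∈ g.support, |g.coeff a| * ∑ i, (a i : ℝ) ^ 2 with hc
  obtain ⟨M, hM⟩ := exists_nat_gt (c / δ)
  set N := max (M + 1) g.totalDegree
  have hN : ∀ a ∈ g.support, ∀ i, a i ≤ N := fun a ha i =>
    ((Finsupp.le_degree i a).trans (le_totalDegree ha)).trans (le_max_right _ _)
  have hNpos : (0 : ℝ) < N := by
    exact_mod_cast (Nat.succ_pos M).trans_le (le_max_left _ _)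
  have hcN : c / N ≤ δ := by
    have hMN : (M : ℝ) ≤ N := by exact_mod_cast (Nat.le_succ M).trans (le_max_left _ _)
    rw [div_le_iff₀ hNpos]
    rw [div_lt_iff₀ hδ] at hM
    nlinarith
  rw [aeval_eq_sum_bernstein y g hN]
  refine S.sum_mem fun κ hκ => S.mul_mem (hS _ ?_) (S.prod_mem fun i _ =>
    S.mul_mem (S.mul_mem (S.pow_mem (hy i) _) (S.pow_mem (hy' i) _)) (natCast_mem S _))
  have hκN : ∀ i, κ i ≤ N := fun i => by
    simpa [Nat.lt_succ_iff] using Fintype.mem_piFinset.1 hκ i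
  have hq : ∀ i, 0 ≤ (κ i : ℝ) / N ∧ (κ i : ℝ) / N ≤ 1 := fun i =>
    ⟨by positivity, div_le_one_of_le₀ (by exact_mod_cast hκN i) hNpos.le⟩
  have hge := hg (fun i => (κ i : ℝ) / N) hq
  rw [eval_eq'] at hge
  have hdiff : |∑ a ∈ g.support, g.coeff a *
        ∏ i, (((κ i).descFactorial (a i) : ℝ) / N.descFactorial (a i))
      - ∑ a ∈ g.support, g.coeff a * ∏ i, ((κ i : ℝ) / N) ^ a i| ≤ c / N := by
    rw [← Finset.sum_sub_distrib, hc, Finset.sum_div]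
    refine (Finset.abs_sum_le_sum_abs _ _).trans (Finset.sum_le_sum fun a ha => ?_)
    rw [← mul_sub, abs_mul, mul_div_assoc, Finset.sum_div]
    gcongr
    refine (abs_prod_sub_prod_le _ _ _ (fun i _ => ?_) (fun i _ => ?_)).trans
      (Finset.sum_le_sum fun i _ => abs_descFactorial_div_sub_pow_le (hκN i) (hN a ha i))
    · obtain ⟨h0, h1⟩ := descFactorial_div_mem_Icc (hκN i) (a i)
      rwa [abs_of_nonneg h0]
    · rw [abs_of_nonneg (pow_nonneg (hq i).1 _)]
      exact pow_le_one₀ (hq i).1 (hq i).2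
  linarith [(abs_le.1 hdiff).1]

end Bernstein

section CoeffNorm

variable {σ : Type*}

/-- The sum of the absolute values of the coefficients. -/
noncomputable def coeffNorm (f : MvPolynomial σ ℝ) : ℝ := ∑ m ∈ f.support, |f.coeff m|

theorem coeffNorm_eq_sum (f : MvPolynomial σ ℝ) {s : Finset (σ →₀ ℕ)} (hs : f.support ⊆ s) :
    coeffNorm f = ∑ m ∈ s, |f.coeff m| :=
  Finset.sum_subset hs fun m _ hm => by rw [notMem_support_iff.1 hm, abs_zero]

theorem coeffNorm_nonneg (f : MvPolynomial σ ℝ) : 0 ≤ coeffNorm f :=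
  Finset.sum_nonneg fun _ _ => abs_nonneg _

@[simp] theorem coeffNorm_zero : coeffNorm (0 : MvPolynomial σ ℝ) = 0 := by simp [coeffNorm]

@[simp] theorem coeffNorm_neg (f : MvPolynomial σ ℝ) : coeffNorm (-f) = coeffNorm f := by
  simp [coeffNorm]

theorem coeffNorm_monomial (m : σ →₀ ℕ) (a : ℝ) : coeffNorm (monomial m a) = |a| := by
  classical
  rw [coeffNorm_eq_sum _ support_monomial_subset]
  simp

theorem coeffNorm_add_le (f g : MvPolynomial σ ℝ) :
    coeffNorm (f + g) ≤ coeffNorm f + coeffNorm g := by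
  classical
  rw [coeffNorm_eq_sum (f + g) support_add, coeffNorm_eq_sum f Finset.subset_union_left,
    coeffNorm_eq_sum g Finset.subset_union_right, ← Finset.sum_add_distrib]
  exact Finset.sum_le_sum fun m _ => by rw [coeff_add]; exact abs_add_le _ _

theorem coeffNorm_sum_le {ι : Type*} (s : Finset ι) (f : ι → MvPolynomial σ ℝ) :
    coeffNorm (∑ i ∈ s, f i) ≤ ∑ i ∈ s, coeffNorm (f i) :=
  Finset.le_sum_of_subadditive coeffNorm coeffNorm_zero.le coeffNorm_add_le s f

theorem coeffNorm_mul_le (f g : MvPolynomial σ ℝ) :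
    coeffNorm (f * g) ≤ coeffNorm f * coeffNorm g := by
  conv_lhs => rw [f.as_sum, g.as_sum, Finset.sum_mul_sum]
  refine (coeffNorm_sum_le _ _).trans ?_
  rw [coeffNorm, coeffNorm, Finset.sum_mul_sum]
  refine Finset.sum_le_sum fun i _ => (coeffNorm_sum_le _ _).trans (Finset.sum_le_sum fun j _ => ?_)
  rw [monomial_mul, coeffNorm_monomial, abs_mul]

end CoeffNorm

section SumSq

variable {σ : Type*}

theorem IsSumSq.congr {A : Type*} [CommRing A] {a b : A} (ha : IsSumSq a) (h : a = b) :
    IsSumSq b := h ▸ ha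

theorem isSumSq_C {c : ℝ} (hc : 0 ≤ c) : IsSumSq (C c : MvPolynomial σ ℝ) := by
  rw [← Real.mul_self_sqrt hc, C_mul]
  exact IsSumSq.mul_self _

/-- The subsemiring of polynomials that are limits of sums of squares for `coeffNorm`. -/
noncomputable def sumSqClosure (σ : Type*) : Subsemiring (MvPolynomial σ ℝ) where
  carrier := {f | ∀ ε > 0, ∃ q, IsSumSq q ∧ coeffNorm (f - q) < ε}
  zero_mem' := fun ε hε => ⟨0, IsSumSq.zero, by simpa using hε⟩
  one_mem' := fun ε hε => ⟨1, IsSumSq.one, by simpa using hε⟩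
  add_mem' := by
    intro f g hf hg ε hε
    obtain ⟨p, hp, hfp⟩ := hf (ε / 2) (half_pos hε)
    obtain ⟨q, hq, hgq⟩ := hg (ε / 2) (half_pos hε)
    refine ⟨p + q, hp.add hq, ?_⟩
    rw [add_sub_add_comm]
    linarith [coeffNorm_add_le (f - p) (g - q)]
  mul_mem' := by
    intro f g hf hg ε hε
    have hg0 := coeffNorm_nonneg g
    obtain ⟨p, hp, hfp⟩ := hf (ε / 2 / (coeffNorm g + 1)) (by positivity)
    have hp0 := coeffNorm_nonneg p
    obtain ⟨q, hq, hgq⟩ := hg (ε / 2 / (coeffNorm p + 1)) (by positivity)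
    refine ⟨p * q, hp.mul hq, ?_⟩
    rw [lt_div_iff₀ (by positivity)] at hfp hgq
    have h := coeffNorm_add_le ((f - p) * g) (p * (g - q))
    have h1 := coeffNorm_mul_le (f - p) g
    have h2 := coeffNorm_mul_le p (g - q)
    rw [show f * g - p * q = (f - p) * g + p * (g - q) by ring]
    nlinarith [coeffNorm_nonneg (f - p), coeffNorm_nonneg (g - q)]

theorem IsSumSq.mem_sumSqClosure {f : MvPolynomial σ ℝ} (hf : IsSumSq f) : f ∈ sumSqClosure σ :=
  fun ε hε => ⟨f, hf, by simpa using hε⟩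

/-- Iterates converging to `1 - √(1 - z)`. -/
noncomputable def sqrtIter {A : Type*} [CommRing A] [Algebra ℝ A] (z : A) : ℕ → A
  | 0 => 0
  | k + 1 => (2⁻¹ : ℝ) • (z + sqrtIter z k ^ 2)

theorem coeffNorm_smul (c : ℝ) (f : MvPolynomial σ ℝ) : coeffNorm (c • f) ≤ |c| * coeffNorm f := by
  have := coeffNorm_mul_le (C c) f
  rwa [C_mul', ← monomial_zero', coeffNorm_monomial] at this

theorem sqrtIter_succ_sub {A : Type*} [CommRing A] [Algebra ℝ A] (z : A) (k : ℕ) :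
    sqrtIter z (k + 2) - sqrtIter z (k + 1) = (2⁻¹ : ℝ) •
      ((sqrtIter z (k + 1) - sqrtIter z k) * (sqrtIter z (k + 1) + sqrtIter z k)) := by
  rw [sqrtIter.eq_2 z (k + 1), sqrtIter.eq_2 z k, ← smul_sub]
  congr 1
  rw [← sqrtIter.eq_2 z k]
  ring

theorem one_sub_sub_sq_sqrtIter {A : Type*} [CommRing A] [Algebra ℝ A] (z : A) (k : ℕ) :
    1 - z - (1 - sqrtIter z k) ^ 2 = (-2 : ℝ) • (sqrtIter z (k + 1) - sqrtIter z k) := by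
  rw [sqrtIter, smul_sub, smul_smul]
  norm_num
  rw [show (2 : ℝ) • sqrtIter z k = 2 * sqrtIter z k by
    rw [Algebra.smul_def, map_ofNat]]
  ring

theorem coeffNorm_sqrtIter_le {z : MvPolynomial σ ℝ} (hz : coeffNorm z ≤ 1) (k : ℕ) :
    coeffNorm (sqrtIter z k) ≤ sqrtIter (1 : ℝ) k := by
  induction k with
  | zero => simp [sqrtIter]
  | succ k ih =>
    rw [sqrtIter, sqrtIter, smul_eq_mul, pow_two, pow_two]
    have h0 := coeffNorm_nonneg (sqrtIter z k)
    have h1 := coeffNorm_smul 2⁻¹ (z + sqrtIter z k * sqrtIter z k)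
    have h2 := coeffNorm_add_le z (sqrtIter z k * sqrtIter z k)
    have h3 := coeffNorm_mul_le (sqrtIter z k) (sqrtIter z k)
    have h4 := mul_self_le_mul_self h0 ih
    rw [abs_of_pos (by norm_num)] at h1
    linarith

theorem coeffNorm_sqrtIter_sub_le {z : MvPolynomial σ ℝ} (hz : coeffNorm z ≤ 1) (k : ℕ) :
    coeffNorm (sqrtIter z (k + 1) - sqrtIter z k)
      ≤ sqrtIter (1 : ℝ) (k + 1) - sqrtIter (1 : ℝ) k := by
  induction k with
  | zero => simpa [sqrtIter] using coeffNorm_sqrtIter_le hz 1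
  | succ k ih =>
    rw [sqrtIter_succ_sub, sqrtIter_succ_sub, smul_eq_mul]
    refine (coeffNorm_smul _ _).trans ?_
    rw [abs_of_pos (by norm_num)]
    refine mul_le_mul_of_nonneg_left ((coeffNorm_mul_le _ _).trans
      (mul_le_mul ih ((coeffNorm_add_le _ _).trans (add_le_add (coeffNorm_sqrtIter_le hz _)
        (coeffNorm_sqrtIter_le hz _))) (coeffNorm_nonneg _) ?_)) (by norm_num)
    exact (coeffNorm_nonneg _).trans ih

theorem tendsto_sqrtIter_one_sub :
    Filter.Tendsto (fun k => sqrtIter (1 : ℝ) (k + 1) - sqrtIter (1 : ℝ) k) Filter.atTop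
      (nhds 0) := by
  have hb : ∀ k, 0 ≤ sqrtIter (1 : ℝ) k ∧ sqrtIter (1 : ℝ) k ≤ 1 := by
    intro k
    induction k with
    | zero => simp [sqrtIter]
    | succ k ih => rw [sqrtIter, smul_eq_mul]; constructor <;> nlinarith [ih.1, ih.2]
  have hmono : Monotone (sqrtIter (1 : ℝ)) := monotone_nat_of_le_succ fun k => by
    rw [sqrtIter, smul_eq_mul]; nlinarith [sq_nonneg (1 - sqrtIter (1 : ℝ) k)]
  have hlim := tendsto_atTop_ciSup hmono ⟨1, by rintro _ ⟨k, rfl⟩; exact (hb k).2⟩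
  simpa using (hlim.comp (Filter.tendsto_add_atTop_nat 1)).sub hlim

theorem one_sub_mem_sumSqClosure {z : MvPolynomial σ ℝ} (hz : coeffNorm z ≤ 1) :
    1 - z ∈ sumSqClosure σ := by
  intro ε hε
  obtain ⟨k, hk⟩ := (tendsto_sqrtIter_one_sub.eventually (gt_mem_nhds (half_pos hε))).exists
  refine ⟨(1 - sqrtIter z k) ^ 2, by rw [pow_two]; exact IsSumSq.mul_self _, ?_⟩
  rw [one_sub_sub_sq_sqrtIter]
  have h1 := coeffNorm_smul (-2) (sqrtIter z (k + 1) - sqrtIter z k)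
  have h2 := coeffNorm_sqrtIter_sub_le hz k
  rw [abs_neg, abs_two] at h1
  linarith

theorem isSumSq_pow_add_pow_sub {A : Type*} [CommRing A] (x y : A) {b r : ℕ} (hb : b ≤ r) :
    IsSumSq (x ^ (2 * r) + y ^ (2 * r) - x ^ (2 * b) * y ^ (2 * (r - b))
      - y ^ (2 * b) * x ^ (2 * (r - b))) := by
  obtain ⟨c, rfl⟩ := Nat.exists_eq_add_of_le hb
  rw [Nat.add_sub_cancel_left]
  obtain ⟨u, hu⟩ : ∃ u : A, u = ∑ i ∈ Finset.range b, (x ^ 2) ^ i * (y ^ 2) ^ (b - 1 - i) := ⟨_, rfl⟩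
  obtain ⟨v, hv⟩ : ∃ v : A, v = ∑ i ∈ Finset.range c, (x ^ 2) ^ i * (y ^ 2) ^ (c - 1 - i) := ⟨_, rfl⟩
  have hgeom : ∀ m, IsSumSq (∑ i ∈ Finset.range m, (x ^ 2) ^ i * (y ^ 2) ^ (m - 1 - i)) :=
    fun m => IsSumSq.sum fun i _ => by
      rw [← pow_mul, ← pow_mul, mul_comm 2, mul_comm 2, pow_mul, pow_mul, ← mul_pow, pow_two]
      exact IsSumSq.mul_self _
  have hb' := (Commute.all (x ^ 2) (y ^ 2)).geom_sum₂_mul b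
  have hc' := (Commute.all (x ^ 2) (y ^ 2)).geom_sum₂_mul c
  rw [← hu, ← pow_mul, ← pow_mul] at hb'
  rw [← hv, ← pow_mul, ← pow_mul] at hc'
  have : x ^ (2 * (b + c)) + y ^ (2 * (b + c)) - x ^ (2 * b) * y ^ (2 * c)
      - y ^ (2 * b) * x ^ (2 * c) = u * v * ((x ^ 2 - y ^ 2) * (x ^ 2 - y ^ 2)) := by
    rw [show u * v * ((x ^ 2 - y ^ 2) * (x ^ 2 - y ^ 2))
      = (u * (x ^ 2 - y ^ 2)) * (v * (x ^ 2 - y ^ 2)) by ring, hb', hc']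
    ring
  rw [this, hu, hv]
  exact ((hgeom b).mul (hgeom c)).mul (IsSumSq.mul_self _)

theorem isSumSq_even_pow {A : Type*} [CommRing A] (x : A) (b : ℕ) : IsSumSq (x ^ (2 * b)) := by
  rw [two_mul, pow_add]; exact IsSumSq.mul_self _

theorem isSumSq_pow_add_pow_sub_mul {A : Type*} [CommRing A] (x y : A) {b r : ℕ} (hb : b ≤ r) :
    IsSumSq (x ^ (2 * r) + y ^ (2 * r) - x ^ (2 * b) * y ^ (2 * (r - b))) := by
  have := (isSumSq_pow_add_pow_sub x y hb).add
    ((isSumSq_even_pow y b).mul (isSumSq_even_pow x (r - b)))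
  rwa [sub_add_cancel] at this

theorem isSumSq_one_add_pow_sub {A : Type*} [CommRing A] (x : A) {b r : ℕ} (hb : b ≤ r) :
    IsSumSq (1 + x ^ (2 * r) - x ^ (2 * b)) := by
  have := isSumSq_pow_add_pow_sub_mul x 1 hb
  rwa [one_pow, one_pow, mul_one, add_comm] at this

/-- An even power product of degree at most `2 * r` is dominated by the sum of the `2 * r`-th
powers, with a constant independent of `r` and of the exponents. -/
theorem exists_isSumSq_mul_one_add_sum_pow_sub_prod {A ι : Type*} [CommRing A] (x : ι → A)
    (s : Finset ι) : ∃ K : ℕ, ∀ (β : ι → ℕ) (r : ℕ), ∑ i ∈ s, β i ≤ r →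
      IsSumSq (K * (1 + ∑ i ∈ s, x i ^ (2 * r)) - ∏ i ∈ s, x i ^ (2 * β i)) := by
  classical
  induction s using Finset.induction_on with
  | empty => exact ⟨1, fun β r _ => by simp⟩
  | insert j s hj ih =>
    obtain ⟨K, hK⟩ := ih
    refine ⟨K * (s.card + 1), fun β r hβ => ?_⟩
    rw [Finset.sum_insert hj] at hβ
    have hjr : β j ≤ r := by omega
    have h1 := (isSumSq_even_pow (x j) (β j)).mul (hK β (r - β j) (by omega))
    have h2 : IsSumSq (∑ i ∈ s, (x j ^ (2 * r) + x i ^ (2 * r)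
        - x j ^ (2 * β j) * x i ^ (2 * (r - β j)))) :=
      IsSumSq.sum fun i _ => isSumSq_pow_add_pow_sub_mul (x j) (x i) hjr
    have h3 := isSumSq_one_add_pow_sub (x j) hjr
    have h4 : IsSumSq ((K : A) * (s.card * (1 + ∑ i ∈ s, x i ^ (2 * r)))) :=
      (IsSumSq.natCast K).mul ((IsSumSq.natCast _).mul
        (IsSumSq.one.add (IsSumSq.sum fun i _ => isSumSq_even_pow _ _)))
    have h5 := (h1.add ((IsSumSq.natCast K).mul (h2.add h3))).add h4
    rw [Finset.sum_insert hj, Finset.prod_insert hj]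
    rw [Finset.sum_sub_distrib, Finset.sum_add_distrib, ← Finset.mul_sum, Finset.sum_const,
      nsmul_eq_mul] at h5
    refine h5.congr ?_
    push_cast
    ring

end SumSq

theorem isSumSq_Theta_sub_one (n r : ℕ) : IsSumSq (Theta n r - 1) := by
  rw [Theta, add_sub_cancel_left]
  exact IsSumSq.sum fun i _ => isSumSq_even_pow _ _

theorem isSumSq_Theta (n r : ℕ) : IsSumSq (Theta n r) := by
  simpa using (isSumSq_Theta_sub_one n r).add IsSumSq.one

theorem exists_isSumSq_Theta_add_monomial (n : ℕ) :
    ∃ K : ℝ, 0 ≤ K ∧ ∀ (m : Fin n →₀ ℕ) (a : ℝ) (r : ℕ), m.degree ≤ r →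
      IsSumSq (C (K * |a|) * Theta n r + monomial m a) := by
  obtain ⟨K, hK⟩ := exists_isSumSq_mul_one_add_sum_pow_sub_prod
    (X : Fin n → MvPolynomial (Fin n) ℝ) Finset.univ
  refine ⟨(K + 1) / 2, by positivity, fun m a r hm => ?_⟩
  obtain ⟨p, hp⟩ : ∃ p : MvPolynomial (Fin n) ℝ, p = ∏ i, X i ^ m i := ⟨_, rfl⟩
  have hprod := hK m r (by rwa [← Finsupp.degree_eq_sum])
  have hp2 : ∏ i, (X i : MvPolynomial (Fin n) ℝ) ^ (2 * m i) = p ^ 2 := by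
    rw [hp, ← Finset.prod_pow]
    exact Finset.prod_congr rfl fun i _ => by rw [mul_comm, pow_mul]
  rw [hp2] at hprod
  have hmon : monomial m a = C a * p := by
    rw [monomial_eq, hp, Finsupp.prod_fintype _ _ fun i => pow_zero _]
  obtain ⟨e, he, hea⟩ : ∃ e : ℝ, e * e = 1 ∧ a = |a| * e := by
    rcases le_total 0 a with h | h
    · exact ⟨1, by norm_num, by rw [abs_of_nonneg h, mul_one]⟩
    · exact ⟨-1, by norm_num, by rw [abs_of_nonpos h]; ring⟩
  have h := (isSumSq_C (σ := Fin n) (div_nonneg (abs_nonneg a) two_pos.le)).mul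
    ((hprod.add (isSumSq_Theta_sub_one n r)).add (IsSumSq.mul_self (1 + C e * p)))
  refine h.congr ?_
  have hC : (C e : MvPolynomial (Fin n) ℝ) * C e = 1 := by rw [← C_mul, he, C_1]
  have hCa : (C a : MvPolynomial (Fin n) ℝ) = 2 * C (|a| / 2) * C e := by
    rw [← map_ofNat (C : ℝ →+* MvPolynomial (Fin n) ℝ) 2, ← C_mul, ← C_mul]
    congr 1
    linarith
  have hCK : (C ((K + 1) / 2 * |a|) : MvPolynomial (Fin n) ℝ) =
      C (|a| / 2) * ((K : MvPolynomial (Fin n) ℝ) + 1) := by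
    rw [← map_natCast (C : ℝ →+* MvPolynomial (Fin n) ℝ) K, ← C_1, ← C_add, ← C_mul]
    congr 1
    ring
  rw [hmon, hCa, hCK, ← Theta]
  linear_combination (C (|a| / 2) * p ^ 2) * hC

theorem exists_isSumSq_Theta_add (n : ℕ) :
    ∃ K : ℝ, 0 ≤ K ∧ ∀ (f : MvPolynomial (Fin n) ℝ) (r : ℕ), f.totalDegree ≤ r →
      IsSumSq (C (K * coeffNorm f) * Theta n r + f) := by
  obtain ⟨K, hK0, hK⟩ := exists_isSumSq_Theta_add_monomial n
  refine ⟨K, hK0, fun f r hr => ?_⟩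
  have h : IsSumSq (∑ m ∈ f.support,
      (C (K * |f.coeff m|) * Theta n r + monomial m (f.coeff m))) :=
    IsSumSq.sum fun m hm => hK m _ r ((le_totalDegree hm).trans hr)
  rwa [Finset.sum_add_distrib, ← f.as_sum, ← Finset.sum_mul, ← map_sum, ← Finset.mul_sum] at h

theorem exists_isSumSq_add_Theta_of_mem_sumSqClosure {n : ℕ} {f : MvPolynomial (Fin n) ℝ}
    (hf : f ∈ sumSqClosure (Fin n)) {ε : ℝ} (hε : 0 < ε) :
    ∃ r0 : ℕ, ∀ r : ℕ, r0 ≤ r → IsSumSq (f + C ε * Theta n r) := by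
  obtain ⟨K, hK0, hK⟩ := exists_isSumSq_Theta_add n
  obtain ⟨q, hq, hfq⟩ := hf (ε / (K + 1)) (by positivity)
  rw [lt_div_iff₀ (by positivity)] at hfq
  refine ⟨(f - q).totalDegree, fun r hr => ?_⟩
  have hc : 0 ≤ ε - K * coeffNorm (f - q) := by nlinarith [coeffNorm_nonneg (f - q)]
  have h := (hq.add (hK (f - q) r hr)).add ((isSumSq_C hc).mul (isSumSq_Theta n r))
  refine h.congr ?_
  rw [C_sub]
  ring

theorem add_C_mem_sumSqClosure_of_nonneg {σ : Type*} [Fintype σ] {f : MvPolynomial σ ℝ}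
    (hf : ∀ x : σ → ℝ, (∀ i, |x i| ≤ 1) → 0 ≤ eval x f) {δ : ℝ} (hδ : 0 < δ) :
    f + C δ ∈ sumSqClosure σ := by
  have hconst : ∀ c : ℝ, 0 ≤ c → C c ∈ sumSqClosure σ := fun c hc =>
    (isSumSq_C hc).mem_sumSqClosure
  have hX : ∀ i, coeffNorm (X i : MvPolynomial σ ℝ) ≤ 1 := fun i => by
    rw [X, coeffNorm_monomial, abs_one]
  have h2 : (C (1 / 2) : MvPolynomial σ ℝ) * 2 = 1 := by
    rw [← map_ofNat (C : ℝ →+* MvPolynomial σ ℝ) 2, ← C_mul]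
    norm_num
  have h := aeval_mem_of_le_eval (sumSqClosure σ) hconst (fun i => C (1 / 2) * (1 + X i))
    (fun i => (sumSqClosure σ).mul_mem (hconst _ (by norm_num)) (by
      simpa using one_sub_mem_sumSqClosure ((coeffNorm_neg (X i)).trans_le (hX i))))
    (fun i => by
      rw [show (1 : MvPolynomial σ ℝ) - C (1 / 2) * (1 + X i) = C (1 / 2) * (1 - X i) by
        linear_combination -h2]
      exact (sumSqClosure σ).mul_mem (hconst _ (by norm_num)) (one_sub_mem_sumSqClosure (hX i)))
    (aeval (fun i => 2 * X i - 1) (f + C δ)) hδ (fun x hx => ?_)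
  · rw [← AlgHom.comp_apply, comp_aeval] at h
    convert h
    rw [show (fun i => (aeval fun i => C (1 / 2) * (1 + X i)) (2 * X i - 1 : MvPolynomial σ ℝ))
      = (X : σ → MvPolynomial σ ℝ) from funext fun i => by
        simp only [map_sub, map_mul, map_ofNat, aeval_X, map_one]
        linear_combination (1 + X i) * h2, aeval_X_left, AlgHom.id_apply]
  · have hx' := hf (fun i => 2 * x i - 1) fun i => by
      rw [abs_le]; constructor <;> linarith [(hx i).1, (hx i).2]
    have : eval x (aeval (fun i => 2 * X i - 1 : σ → MvPolynomial σ ℝ) (f + C δ))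
        = eval (fun i => 2 * x i - 1) (f + C δ) := by
      rw [← coe_aeval_eq_eval, ← coe_aeval_eq_eval, RingHom.coe_coe, RingHom.coe_coe,
        ← AlgHom.comp_apply, comp_aeval]
      simp
    rw [this, map_add, eval_C]
    linarith

/-- If `f` is nonnegative on `[-1,1]^n`, then for each `ε > 0` there is `r(f,ε)`
such that `f + ε Θ_r` is a sum of squares for all `r ≥ r(f,ε)`. -/
theorem stmt_4 (n : ℕ) (f : MvPolynomial (Fin n) ℝ)
    (hf : ∀ x : Fin n → ℝ, (∀ i, |x i| ≤ 1) → 0 ≤ eval x f)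
    (ε : ℝ) (hε : 0 < ε) :
    ∃ r0 : ℕ, ∀ r : ℕ, r0 ≤ r → IsSumSq (f + C ε * Theta n r) := by
  obtain ⟨r0, hr0⟩ := exists_isSumSq_add_Theta_of_mem_sumSqClosure
    (add_C_mem_sumSqClosure_of_nonneg hf (half_pos hε)) (half_pos hε)
  refine ⟨r0, fun r hr => ?_⟩
  have h := (hr0 r hr).add ((isSumSq_C (half_pos hε).le).mul (isSumSq_Theta_sub_one n r))
  refine h.congr ?_
  have h2 : (C ε : MvPolynomial (Fin n) ℝ) = C (ε / 2) + C (ε / 2) := by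
    rw [← C_add, add_halves]
  rw [h2]
  ring
end

section
/- Let S = {g_1,…,g_s} be a finite set of real polynomials in n variables. Suppose the Moment Problem is solvable for S and that the basic closed semi-algebraic set K_S has nonempty interior. Let f be a real polynomial nonnegative on K_S ∩ [−1,1]^n (only), and let ε > 0 be fixed. Then there exists r(f,ε,S) ∈ ℕ such that for every r ≥ r(f,ε,S), the polynomial f + ε·Θ_r lies in the preordering T_S. -/
open MvPolynomial MeasureTheory

/-- Membership in the preordering `T_S` generated by `S = {g_1,…,g_s}`: finite sums of
terms `σ_e · g_1^{e_1} ⋯ g_s^{e_s}` with `e ∈ {0,1}^s` and `σ_e` a sum of squares. -/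
def InPreordering {n s : ℕ} (g : Fin s → MvPolynomial (Fin n) ℝ)
    (p : MvPolynomial (Fin n) ℝ) : Prop :=
  ∃ σ : (Fin s → Bool) → MvPolynomial (Fin n) ℝ,
    (∀ e, IsSumSq (σ e)) ∧
    p = ∑ e : Fin s → Bool, σ e * ∏ i, if e i then g i else 1

/-- The basic closed semi-algebraic set `K_S`. -/
def KSet {n s : ℕ} (g : Fin s → MvPolynomial (Fin n) ℝ) : Set (Fin n → ℝ) :=
  {x | ∀ i, 0 ≤ eval x (g i)}

/-- The Moment Problem is solvable for `S`: every linear functional nonnegative on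
`T_S` is integration with respect to some measure supported on `K_S`. -/
def MomentProblemSolvable {n s : ℕ} (g : Fin s → MvPolynomial (Fin n) ℝ) : Prop :=
  ∀ L : MvPolynomial (Fin n) ℝ →ₗ[ℝ] ℝ,
    (∀ t : MvPolynomial (Fin n) ℝ, InPreordering g t → 0 ≤ L t) →
    ∃ μ : Measure (Fin n → ℝ),
      μ (KSet g)ᶜ = 0 ∧
      (∀ p : MvPolynomial (Fin n) ℝ, Integrable (fun x => eval x p) μ) ∧
      (∀ p : MvPolynomial (Fin n) ℝ, L p = ∫ x, eval x p ∂μ)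

/-- A point outside a pointed cone with order unit `u` is weakly separated from the cone by a
functional normalised at `u`. -/
theorem PointedCone.exists_linearMap_nonneg_of_orderUnit {E : Type*} [AddCommGroup E] [Module ℝ E]
    (s : PointedCone ℝ E) (u x : E) (hus : u ∈ s) (hu : ∀ y, ∃ a : ℝ, a • u + y ∈ s)
    (hx : x ∉ s) :
    ∃ L : E →ₗ[ℝ] ℝ, (∀ y ∈ s, 0 ≤ L y) ∧ L u = 1 ∧ L x ≤ 0 := by
  have smul_mem : ∀ c : ℝ, 0 ≤ c → ∀ y ∈ s, c • y ∈ s := fun c hc y hy => s.smul_mem hc hy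
  have hu0 : u ≠ 0 := by
    rintro rfl
    obtain ⟨a, ha⟩ := hu x
    simp_all
  let s' : PointedCone ℝ E :=
    { carrier := {z | ∃ c : ℝ, 0 ≤ c ∧ z + c • x ∈ s}
      zero_mem' := ⟨0, le_rfl, by simp⟩
      add_mem' := by
        rintro y z ⟨c, hc, hy⟩ ⟨d, hd, hz⟩
        refine ⟨c + d, by positivity, ?_⟩
        convert s.add_mem hy hz using 1
        module
      smul_mem' := by
        rintro ⟨b, hb⟩ y ⟨c, hc, hy⟩
        refine ⟨b * c, by positivity, ?_⟩
        convert smul_mem b hb _ hy using 1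
        rw [smul_add, smul_smul]
        rfl }
  have hss' : ∀ y ∈ s, y ∈ s' := fun y hy => ⟨0, le_rfl, by simpa using hy⟩
  let φ : E →ₗ.[ℝ] ℝ := LinearPMap.mkSpanSingleton u (1 : ℝ) hu0
  have hφ : ∀ (b : ℝ) (h : b • u ∈ φ.domain), φ ⟨b • u, h⟩ = b := fun b h =>
    (LinearPMap.mkSpanSingleton'_apply u (1 : ℝ) _ b h).trans (mul_one b)
  have hneg : ∀ b : ℝ, b • u ∈ s' → 0 ≤ b := by
    rintro b ⟨c, hc, hb⟩
    by_contra! hb0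
    rcases hc.eq_or_lt with rfl | hc
    · obtain ⟨a, ha⟩ := hu x
      have h1 : (-b) • x ∈ s := by
        rcases le_or_gt a 0 with ha0 | ha0
        · have := smul_mem (-b) (by linarith) _ (s.add_mem ha (smul_mem (-a) (by linarith) _ hus))
          convert this using 1
          module
        · have := s.add_mem (smul_mem (-b) (by linarith) _ ha) (smul_mem a ha0.le _ hb)
          convert this using 1
          module
      apply hx
      convert smul_mem (-b)⁻¹ (by simpa using hb0.le) _ h1 using 1
      rw [smul_smul, inv_mul_cancel₀ (by linarith), one_smul]
    · apply hx
      convert smul_mem c⁻¹ (by positivity) _ (s.add_mem hb (smul_mem (-b) (by linarith) _ hus))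
        using 1
      rw [show b • u + c • x + (-b) • u = c • x by module, smul_smul,
        inv_mul_cancel₀ hc.ne', one_smul]
  obtain ⟨L, hL, hLs⟩ := riesz_extension s' φ
    (by
      rintro ⟨y, hy⟩ hys
      obtain ⟨b, rfl⟩ := Submodule.mem_span_singleton.1 hy
      rw [hφ]
      exact hneg b hys)
    (fun y => by
      obtain ⟨a, ha⟩ := hu y
      exact ⟨⟨a • u, Submodule.mem_span_singleton.2 ⟨a, rfl⟩⟩, hss' _ ha⟩)
  refine ⟨L, fun y hy => hLs y (hss' y hy), ?_, ?_⟩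
  · have h1 : (1 : ℝ) • u ∈ φ.domain := Submodule.mem_span_singleton.2 ⟨1, rfl⟩
    have := hL ⟨(1 : ℝ) • u, h1⟩
    rw [hφ] at this
    simpa using this
  · have := hLs (-x) ⟨1, zero_le_one, by simp⟩
    simpa using this

/-- A function whose even moments are uniformly bounded is almost everywhere bounded by `1`. -/
theorem MeasureTheory.ae_abs_le_one_of_integral_pow_le {Ω : Type*} [MeasurableSpace Ω]
    {μ : Measure Ω} {h : Ω → ℝ} {B : ℝ} (hi : ∀ k : ℕ, Integrable (fun x => h x ^ (2 * k)) μ)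
    (hB : ∀ k : ℕ, ∫ x, h x ^ (2 * k) ∂μ ≤ B) : ∀ᵐ x ∂μ, |h x| ≤ 1 := by
  have hfin : IsFiniteMeasure μ := by
    have := hi 0
    simp only [mul_zero, pow_zero] at this
    exact (integrable_const_iff_isFiniteMeasure one_ne_zero).1 this
  have key : ∀ m : ℕ, ∀ᵐ x ∂μ, |h x| < 1 + 1 / ((m : ℝ) + 1) := by
    intro m
    set b : ℝ := 1 + 1 / ((m : ℝ) + 1) with hb
    have hb1 : 1 < b := by
      have : (0 : ℝ) < 1 / ((m : ℝ) + 1) := by positivity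
      linarith
    rw [ae_iff]
    simp only [not_lt]
    by_contra hne
    have hpos : 0 < μ.real {x | b ≤ |h x|} :=
      ENNReal.toReal_pos hne (measure_ne_top _ _)
    have hle : ∀ k : ℕ, (b ^ 2) ^ k * μ.real {x | b ≤ |h x|} ≤ B := by
      intro k
      have h1 := mul_meas_ge_le_integral_of_nonneg
        (Filter.Eventually.of_forall fun x => (even_two_mul k).pow_nonneg (h x)) (hi k)
        ((b ^ 2) ^ k)
      refine le_trans ?_ (h1.trans (hB k))
      refine mul_le_mul_of_nonneg_left (measureReal_mono ?_) (by positivity)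
      intro x hx
      simp only [Set.mem_ofPred_eq] at hx ⊢
      rw [pow_mul]
      refine pow_le_pow_left₀ (by positivity) ?_ k
      rw [← sq_abs (h x)]
      exact pow_le_pow_left₀ (by positivity) hx 2
    obtain ⟨k, hk⟩ := pow_unbounded_of_one_lt (B / μ.real {x | b ≤ |h x|})
      (show 1 < b ^ 2 by nlinarith)
    rw [div_lt_iff₀ hpos] at hk
    exact absurd (hle k) (not_le.2 hk)
  filter_upwards [ae_all_iff.2 key] with x hx
  refine le_of_forall_pos_le_add fun δ hδ => ?_
  obtain ⟨m, hm⟩ := exists_nat_one_div_lt hδ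
  linarith [hx m]

namespace InPreordering

variable {n s : ℕ} {g : Fin s → MvPolynomial (Fin n) ℝ} {p q : MvPolynomial (Fin n) ℝ}

theorem of_isSumSq (hp : IsSumSq p) : InPreordering g p := by
  classical
  refine ⟨fun e => if e = fun _ => false then p else 0, fun e => ?_, ?_⟩
  · dsimp only
    split_ifs
    · exact hp
    · exact .zero
  · simp [ite_mul]

theorem add (hp : InPreordering g p) (hq : InPreordering g q) : InPreordering g (p + q) := by
  obtain ⟨σ, hσ, rfl⟩ := hp
  obtain ⟨τ, hτ, rfl⟩ := hq
  exact ⟨fun e => σ e + τ e, fun e => (hσ e).add (hτ e), by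
    simp [add_mul, Finset.sum_add_distrib]⟩

theorem isSumSq_mul (hp : IsSumSq p) (hq : InPreordering g q) : InPreordering g (p * q) := by
  obtain ⟨σ, hσ, rfl⟩ := hq
  exact ⟨fun e => p * σ e, fun e => hp.mul (hσ e), by simp [Finset.mul_sum, mul_assoc]⟩

theorem smul {c : ℝ} (hc : 0 ≤ c) (hp : InPreordering g p) : InPreordering g (c • p) := by
  rw [smul_eq_C_mul]
  refine isSumSq_mul ?_ hp
  rw [← Real.mul_self_sqrt hc, C_mul]
  exact .mul_self _

end InPreordering

/-- If `k ≤ r`, then `1 + a ^ (2 r) - a ^ (2 k)` is a sum of squares. -/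
theorem isSumSq_one_add_pow_sub_pow {R : Type*} [CommRing R] (a : R) {k r : ℕ} (h : k ≤ r) :
    IsSumSq (1 + a ^ (2 * r) - a ^ (2 * k)) := by
  obtain ⟨l, rfl⟩ := Nat.exists_eq_add_of_le h
  have hg : ∀ m : ℕ, IsSumSq (∑ i ∈ Finset.range m, (a ^ 2) ^ i) := fun m =>
    IsSumSq.sum fun i _ => ((IsSquare.sq a).pow i).isSumSq
  have e : 1 + a ^ (2 * (k + l)) - a ^ (2 * k)
      = (1 - a ^ 2) * (1 - a ^ 2) * ((∑ i ∈ Finset.range k, (a ^ 2) ^ i) *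
        ∑ i ∈ Finset.range l, (a ^ 2) ^ i) + a ^ l * a ^ l := by
    have hk := mul_neg_geom_sum (a ^ 2) k
    have hl := mul_neg_geom_sum (a ^ 2) l
    calc _ = (1 - (a ^ 2) ^ k) * (1 - (a ^ 2) ^ l) + a ^ l * a ^ l := by
          simp only [mul_add, pow_add, pow_mul]
          rw [← mul_pow, ← pow_two a]
          ring
      _ = _ := by rw [← hk, ← hl]; ring
  rw [e]
  exact ((IsSumSq.mul_self _).mul ((hg k).mul (hg l))).add (.mul_self _)

/-- The pairs `(p, a)` such that `p + a Θ_r` lies in the preordering for all large `r`. -/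
def thetaCone {n s : ℕ} (g : Fin s → MvPolynomial (Fin n) ℝ) :
    PointedCone ℝ (MvPolynomial (Fin n) ℝ × ℝ) where
  carrier := {z | ∃ r0 : ℕ, ∀ r, r0 ≤ r → InPreordering g (z.1 + C z.2 * Theta n r)}
  zero_mem' := ⟨0, fun r _ => .of_isSumSq (by simp)⟩
  add_mem' := by
    rintro ⟨p, a⟩ ⟨q, b⟩ ⟨r1, h1⟩ ⟨r2, h2⟩
    refine ⟨max r1 r2, fun r hr => ?_⟩
    convert (h1 r (le_of_max_le_left hr)).add (h2 r (le_of_max_le_right hr)) using 1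
    simp only [Prod.mk_add_mk, C_add]
    ring
  smul_mem' := by
    rintro ⟨c, hc⟩ ⟨p, a⟩ ⟨r0, h⟩
    refine ⟨r0, fun r hr => ?_⟩
    convert (h r hr).smul hc using 1
    change c • p + C (c * a) * Theta n r = c • (p + C a * Theta n r)
    rw [smul_eq_C_mul, smul_eq_C_mul, C_mul]
    ring

section thetaCone

variable {n s : ℕ} {g : Fin s → MvPolynomial (Fin n) ℝ}

theorem mem_thetaCone {p : MvPolynomial (Fin n) ℝ} {a : ℝ} :
    (p, a) ∈ thetaCone g ↔
      ∃ r0 : ℕ, ∀ r, r0 ≤ r → InPreordering g (p + C a * Theta n r) := Iff.rfl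

theorem mem_thetaCone_zero {p : MvPolynomial (Fin n) ℝ} (hp : InPreordering g p) :
    (p, (0 : ℝ)) ∈ thetaCone g :=
  mem_thetaCone.2 ⟨0, fun r _ => by simpa using hp⟩

theorem neg_X_pow_mem_thetaCone (j : Fin n) (k : ℕ) :
    (-X j ^ (2 * k), (1 : ℝ)) ∈ thetaCone g := by
  refine mem_thetaCone.2 ⟨k, fun r hr => .of_isSumSq ?_⟩
  have e : -X j ^ (2 * k) + C 1 * Theta n r =
      (1 + X j ^ (2 * r) - X j ^ (2 * k)) +
        ∑ i ∈ Finset.univ.erase j, (X i : MvPolynomial (Fin n) ℝ) ^ (2 * r) := by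
    rw [Theta, ← Finset.add_sum_erase _ _ (Finset.mem_univ j), C_1]
    ring
  rw [e]
  exact (isSumSq_one_add_pow_sub_pow _ hr).add
    (.sum fun i _ => ((even_two_mul r).isSquare_pow _).isSumSq)

theorem zero_one_mem_thetaCone : ((0 : MvPolynomial (Fin n) ℝ), (1 : ℝ)) ∈ thetaCone g := by
  refine mem_thetaCone.2 ⟨0, fun r _ => .of_isSumSq ?_⟩
  rw [Theta, zero_add, C_1, one_mul]
  exact IsSumSq.one.add (.sum fun i _ => ((even_two_mul r).isSquare_pow _).isSumSq)

theorem neg_one_one_mem_thetaCone :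
    ((-1 : MvPolynomial (Fin n) ℝ), (1 : ℝ)) ∈ thetaCone g := by
  refine mem_thetaCone.2 ⟨0, fun r _ => .of_isSumSq ?_⟩
  rw [Theta, C_1, one_mul, neg_add_cancel_left]
  exact .sum fun i _ => ((even_two_mul r).isSquare_pow _).isSumSq

/-- If `p²` and `q²` are bounded above, then `2 p q` is bounded below. -/
theorem two_mul_mem_thetaCone {p q : MvPolynomial (Fin n) ℝ} {a b : ℝ}
    (hp : (-p ^ 2, a) ∈ thetaCone g) (hq : (-q ^ 2, b) ∈ thetaCone g) :
    (2 * (p * q), a + b) ∈ thetaCone g := by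
  have h := (thetaCone g).add_mem ((thetaCone g).add_mem hp hq)
    (mem_thetaCone_zero (.of_isSumSq (.mul_self (p + q))))
  convert h using 1
  ext1
  · simp only [Prod.mk_add_mk]
    ring
  · simp

theorem mul_mem_thetaCone {p q : MvPolynomial (Fin n) ℝ}
    (hp : ∃ a : ℝ, (-p ^ 2, a) ∈ thetaCone g) (hq : ∃ a : ℝ, (-q ^ 2, a) ∈ thetaCone g) :
    ∃ a : ℝ, (p * q, a) ∈ thetaCone g := by
  obtain ⟨a, hp⟩ := hp
  obtain ⟨b, hq⟩ := hq
  have h := (thetaCone g).smul_mem (show (0 : ℝ) ≤ 1 / 2 by norm_num)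
    (two_mul_mem_thetaCone hp hq)
  refine ⟨1 / 2 * (a + b), ?_⟩
  convert h using 1
  change _ = ((1 / 2 : ℝ) • (2 * (p * q)), (1 / 2 : ℝ) * (a + b))
  rw [smul_eq_C_mul, ← mul_assoc, show (2 : MvPolynomial (Fin n) ℝ) = C 2 from rfl, ← C_mul]
  norm_num

theorem neg_prod_X_pow_mem_thetaCone (t : Finset (Fin n)) :
    ∀ k : Fin n → ℕ, ∃ a : ℝ,
      (-(∏ j ∈ t, (X j : MvPolynomial (Fin n) ℝ) ^ k j) ^ 2, a) ∈ thetaCone g := by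
  classical
  induction t using Finset.induction_on with
  | empty => exact fun k => ⟨1, by simpa using neg_one_one_mem_thetaCone⟩
  | insert j t hj ih =>
    intro k
    rw [Finset.prod_insert hj, mul_pow, neg_mul_eq_neg_mul]
    refine mul_mem_thetaCone ⟨1, ?_⟩ ?_
    · rw [neg_sq, ← pow_mul, ← pow_mul, show k j * (2 * 2) = 2 * (2 * k j) by ring]
      exact neg_X_pow_mem_thetaCone j _
    · rw [← Finset.prod_pow]
      simpa only [← pow_mul] using ih fun j => k j * 2

theorem exists_mem_thetaCone (p : MvPolynomial (Fin n) ℝ) :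
    ∃ a : ℝ, (p, a) ∈ thetaCone g := by
  induction p using MvPolynomial.induction_on' with
  | monomial d c =>
    have e : monomial d c = C c * ∏ j, (X j : MvPolynomial (Fin n) ℝ) ^ d j := by
      rw [monomial_eq, Finsupp.prod_fintype _ _ (by simp)]
    rw [e]
    refine mul_mem_thetaCone ⟨c ^ 2, ?_⟩ (neg_prod_X_pow_mem_thetaCone _ _)
    have h := (thetaCone g).smul_mem (sq_nonneg c)
      neg_one_one_mem_thetaCone
    convert h using 1
    change _ = (c ^ 2 • (-1 : MvPolynomial (Fin n) ℝ), c ^ 2 * 1)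
    rw [smul_eq_C_mul, C_pow]
    simp
  | add p q hp hq =>
    obtain ⟨a, hp⟩ := hp
    obtain ⟨b, hq⟩ := hq
    exact ⟨a + b, by simpa only [Prod.mk_add_mk] using (thetaCone g).add_mem hp hq⟩

end thetaCone

/-- Same conclusion as before, assuming only that `f` is nonnegative on
`K_S ∩ [-1,1]^n`. -/
theorem stmt_8 (n s : ℕ) (g : Fin s → MvPolynomial (Fin n) ℝ)
    (hmp : MomentProblemSolvable g)
    (hint : (interior (KSet g)).Nonempty)
    (f : MvPolynomial (Fin n) ℝ)
    (hf : ∀ x : Fin n → ℝ, x ∈ KSet g → (∀ i, |x i| ≤ 1) → 0 ≤ eval x f)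
    (ε : ℝ) (hε : 0 < ε) :
    ∃ r0 : ℕ, ∀ r : ℕ, r0 ≤ r → InPreordering g (f + C ε * Theta n r) := by
  change (f, ε) ∈ thetaCone g
  by_contra hfε
  obtain ⟨L, hL, hL1, hLf⟩ := (thetaCone g).exists_linearMap_nonneg_of_orderUnit (0, 1) (f, ε)
    zero_one_mem_thetaCone
    (by
      rintro ⟨p, b⟩
      obtain ⟨a, ha⟩ := exists_mem_thetaCone (g := g) p
      exact ⟨a - b, by simpa using ha⟩) hfε
  have hsplit : ∀ (p : MvPolynomial (Fin n) ℝ) (a : ℝ),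
      L (p, a) = L.comp (LinearMap.inl ℝ _ ℝ) p + a := by
    intro p a
    have : (p, a) = (p, (0 : ℝ)) + a • ((0 : MvPolynomial (Fin n) ℝ), (1 : ℝ)) := by simp
    rw [this, map_add, map_smul, hL1]
    simp
  obtain ⟨μ, hμK, hμi, hμ⟩ := hmp (L.comp (LinearMap.inl ℝ _ ℝ))
    (fun t ht => by simpa using hL _ (mem_thetaCone_zero ht))
  have hcube : ∀ᵐ x ∂μ, ∀ j : Fin n, |x j| ≤ 1 := by
    refine ae_all_iff.2 fun j =>
      ae_abs_le_one_of_integral_pow_le (B := 1) (fun k => ?_) fun k => ?_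
    · simpa using hμi (X j ^ (2 * k))
    · have h1 := hL _ (neg_X_pow_mem_thetaCone (g := g) j k)
      rw [hsplit, map_neg, hμ] at h1
      simp only [map_pow, eval_X] at h1
      linarith
  have hK : ∀ᵐ x ∂μ, x ∈ KSet g := hμK
  have hnonneg : 0 ≤ ∫ x, eval x f ∂μ := by
    refine integral_nonneg_of_ae ?_
    filter_upwards [hcube, hK] with x hx hxK using hf x hxK hx
  rw [hsplit, hμ] at hLf
  linarith
end
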